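/- arXiv:1902.04159 — 7 statements merged into one kernel-verified Lean document; each statement's English description precedes it below -/
import Mathlib

section
/- Let A and B be structures of the same first-order signature. Then B satisfies every existential positive sentence that is true in A if and only if there exists a homomorphism from A into some ultrapower of B. -/
universe u

open FirstOrder Language Structure

namespace Paper

variable {L : FirstOrder.Language.{u, u}}

/-- Existential positive sentences/formulas: built from atomic formulas by
conjunction, disjunction and existential quantification. -/
inductive IsEP : {n : ℕ} → L.BoundedFormula Empty n → Prop
  | equal {n} (t₁ t₂ : L.Term (Empty ⊕ Fin n)) : IsEP (t₁.bdEqual t₂)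
  | rel {n k} (R : L.Relations k) (ts : Fin k → L.Term (Empty ⊕ Fin n)) :
      IsEP (BoundedFormula.rel R ts)
  | sup {n} {φ ψ : L.BoundedFormula Empty n} : IsEP φ → IsEP ψ → IsEP (φ ⊔ ψ)
  | inf {n} {φ ψ : L.BoundedFormula Empty n} : IsEP φ → IsEP ψ → IsEP (φ ⊓ ψ)
  | ex {n} {φ : L.BoundedFormula Empty (n + 1)} : IsEP φ → IsEP φ.ex

/-- The direct-product structure on a product of structures. -/
def piStructure {ι : Type u} (M : ι → Type u) [∀ i, L.Structure (M i)] :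
    L.Structure (∀ i, M i) where
  funMap f x i := funMap f fun j => x j i
  RelMap r x := ∀ i, RelMap r fun j => x j i

/-- An (abstract) class of `L`-structures with universes in `Type u`. -/
def StructClass (L : FirstOrder.Language.{u, u}) : Type (u + 1) :=
  ∀ M : Type u, L.Structure M → Prop

def SubClass (K₁ K₂ : StructClass L) : Prop :=
  ∀ (M : Type u) (iM : L.Structure M), K₁ M iM → K₂ M iM

def EqClass (K₁ K₂ : StructClass L) : Prop :=
  ∀ (M : Type u) (iM : L.Structure M), K₁ M iM ↔ K₂ M iM

/-- A quasivariety: a class of structures closed under isomorphisms,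
substructures, direct products and ultraproducts. -/
structure IsQuasivariety (K : StructClass L) : Prop where
  iso_closed : ∀ (M : Type u) [iM : L.Structure M] (N : Type u) [iN : L.Structure N],
      Nonempty (M ≃[L] N) → K M iM → K N iN
  sub_closed : ∀ (M : Type u) [iM : L.Structure M] (N : Type u) [iN : L.Structure N],
      Nonempty (M ↪[L] N) → K N iN → K M iM
  prod_closed : ∀ (ι : Type u) (M : ι → Type u) [iM : ∀ i, L.Structure (M i)],
      (∀ i, K (M i) (iM i)) → K (∀ i, M i) (piStructure M)
  ultra_closed : ∀ (ι : Type u) (M : ι → Type u) [iM : ∀ i, L.Structure (M i)]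
      (uf : Ultrafilter ι), (∀ i, K (M i) (iM i)) →
      K ((uf : Filter ι).Product M) inferInstance

/-- A variety: a class of structures closed under isomorphisms, homomorphic
images, substructures and direct products. -/
structure IsVariety (K : StructClass L) : Prop where
  iso_closed : ∀ (M : Type u) [iM : L.Structure M] (N : Type u) [iN : L.Structure N],
      Nonempty (M ≃[L] N) → K M iM → K N iN
  hom_closed : ∀ (M : Type u) [iM : L.Structure M] (N : Type u) [iN : L.Structure N],
      (∃ h : M →[L] N, Function.Surjective h) → K M iM → K N iN
  sub_closed : ∀ (M : Type u) [iM : L.Structure M] (N : Type u) [iN : L.Structure N],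
      Nonempty (M ↪[L] N) → K N iN → K M iM
  prod_closed : ∀ (ι : Type u) (M : ι → Type u) [iM : ∀ i, L.Structure (M i)],
      (∀ i, K (M i) (iM i)) → K (∀ i, M i) (piStructure M)

/-- The quasivariety generated by a class. -/
def QGen (C : StructClass L) : StructClass L :=
  fun M iM => ∀ K : StructClass L, IsQuasivariety K → SubClass C K → K M iM

/-- The variety generated by a class. -/
def VGen (C : StructClass L) : StructClass L :=
  fun M iM => ∀ K : StructClass L, IsVariety K → SubClass C K → K M iM

/-- The class of isomorphic copies of a single structure. -/
def ClassOf (A : Type u) [iA : L.Structure A] : StructClass L :=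
  fun M iM => Nonempty (@FirstOrder.Language.Equiv L M A iM iA)

/-- A class is nontrivial when it has a member with at least two elements. -/
def NontrivialClass (K : StructClass L) : Prop :=
  ∃ (M : Type u) (iM : L.Structure M), K M iM ∧ Nontrivial M

/-- The joint embedding property. -/
def HasJEP (K : StructClass L) : Prop :=
  ∀ (A : Type u) [iA : L.Structure A] (B : Type u) [iB : L.Structure B],
    K A iA → K B iB → Nontrivial A → Nontrivial B →
    ∃ (C : Type u) (iC : L.Structure C), K C iC ∧
      Nonempty (@FirstOrder.Language.Embedding L A C iA iC) ∧
      Nonempty (@FirstOrder.Language.Embedding L B C iB iC)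

/-- There is a homomorphism from `A` into some ultrapower of `B`. -/
def MapsIntoUltrapower (L : FirstOrder.Language.{u, u}) (A B : Type u)
    [iA : L.Structure A] [iB : L.Structure B] : Prop :=
  ∃ (ι : Type u) (uf : Ultrafilter ι),
    Nonempty (A →[L] ((uf : Filter ι).Product fun _ : ι => B))

/-- There is an embedding of `A` into some ultrapower of `B`. -/
def EmbedsIntoUltrapower (L : FirstOrder.Language.{u, u}) (A B : Type u)
    [iA : L.Structure A] [iB : L.Structure B] : Prop :=
  ∃ (ι : Type u) (uf : Ultrafilter ι),
    Nonempty (A ↪[L] ((uf : Filter ι).Product fun _ : ι => B))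

/-- Passive structural completeness: all nontrivial members satisfy the same
existential positive sentences. -/
def IsPSC (K : StructClass L) : Prop :=
  ∀ (A : Type u) [iA : L.Structure A] (B : Type u) [iB : L.Structure B],
    K A iA → K B iB → Nontrivial A → Nontrivial B →
    ∀ φ : L.Sentence, IsEP φ → (A ⊨ φ → B ⊨ φ)

/-- A relatively simple (K-simple) member of `K`. -/
def RelSimple (K : StructClass L) (A : Type u) [iA : L.Structure A] : Prop :=
  K A iA ∧ Nontrivial A ∧
    ∀ (B : Type u) [iB : L.Structure B], K B iB → Nontrivial B →
      ∀ h : A →[L] B, Function.Surjective h → Function.Injective h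

/-- The class of relatively simple members of `K`. -/
def RelSimpleClass (K : StructClass L) : StructClass L :=
  fun A iA => @RelSimple L K A iA

/-- A relatively subdirectly irreducible member of `K`. -/
def RelSDI (K : StructClass L) (A : Type u) [iA : L.Structure A] : Prop :=
  K A iA ∧
    ∀ (ι : Type u) (M : ι → Type u) [iM : ∀ i, L.Structure (M i)],
      (∀ i, K (M i) (iM i)) →
      ∀ h : @FirstOrder.Language.Embedding L A (∀ i, M i) iA (piStructure M),
        (∀ i, Function.Surjective fun a => h a i) →
        ∃ i, Function.Bijective fun a => h a i

/-- The class of relatively subdirectly irreducible members of `K`. -/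
def RelSDIClass (K : StructClass L) : StructClass L :=
  fun A iA => @RelSDI L K A iA

/-- `K` is relatively semisimple. -/
def RelSemisimple (K : StructClass L) : Prop :=
  ∀ (M : Type u) [iM : L.Structure M], K M iM → RelSDI K M → RelSimple K M

/-- A congruence of a structure. -/
def IsCong (L : FirstOrder.Language.{u, u}) (A : Type u) [iA : L.Structure A] (θ : Setoid A) : Prop :=
  (∀ (n : ℕ) (f : L.Functions n) (x y : Fin n → A),
      (∀ i, θ.r (x i) (y i)) → θ.r (funMap f x) (funMap f y)) ∧
  (∀ (n : ℕ) (r : L.Relations n) (x y : Fin n → A),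
      (∀ i, θ.r (x i) (y i)) → (RelMap r x ↔ RelMap r y))

/-- The prestructure determined by a congruence. -/
def congPrestructure (L : FirstOrder.Language.{u, u}) (A : Type u) [iA : L.Structure A]
    (θ : Setoid A) (h : IsCong L A θ) : L.Prestructure θ where
  toStructure := iA
  fun_equiv := fun x y hxy => h.1 _ _ x y fun i => hxy i
  rel_equiv := fun x y hxy => propext (h.2 _ _ x y fun i => hxy i)

/-- The quotient structure by a congruence. -/
def quotStructure (L : FirstOrder.Language.{u, u}) (A : Type u) [iA : L.Structure A]
    (θ : Setoid A) (h : IsCong L A θ) : L.Structure (Quotient θ) :=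
  @FirstOrder.Language.quotientStructure L A θ (congPrestructure L A θ h)

/-- A `K`-congruence (relative congruence) of `A`. -/
def IsKCong (K : StructClass L) (A : Type u) [iA : L.Structure A] (θ : Setoid A) : Prop :=
  ∃ h : IsCong L A θ, K (Quotient θ) (quotStructure L A θ h)

/-- The total relation `A × A` is a compact element of the lattice of
`K`-congruences of `A`. -/
def TopKCompact (K : StructClass L) (A : Type u) [iA : L.Structure A] : Prop :=
  ∀ S : Set (Setoid A), (∀ θ ∈ S, IsKCong K A θ) →
    (∀ θ : Setoid A, IsKCong K A θ → (∀ σ ∈ S, σ ≤ θ) → θ = ⊤) →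
    ∃ S₀ : Set (Setoid A), S₀ ⊆ S ∧ S₀.Finite ∧
      ∀ θ : Setoid A, IsKCong K A θ → (∀ σ ∈ S₀, σ ≤ θ) → θ = ⊤

/-- `A` has a homomorphic image in `K` that is `K`-simple. -/
def HasRelSimpleImage (K : StructClass L) (A : Type u) [iA : L.Structure A] : Prop :=
  ∃ (B : Type u) (iB : L.Structure B), K B iB ∧
    (∃ h : @FirstOrder.Language.Hom L A B iA iB, Function.Surjective h) ∧
    @RelSimple L K B iB

/-- The language has finitely many operation and relation symbols. -/
def FiniteType (L : FirstOrder.Language.{u, u}) : Prop :=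
  Finite (Σ n, L.Functions n) ∧ Finite (Σ n, L.Relations n)

/-- An algebra is `0`-generated when it is generated by the empty set. -/
def ZeroGen (L : FirstOrder.Language.{u, u}) (A : Type u) [iA : L.Structure A] : Prop :=
  Substructure.closure L (∅ : Set A) = ⊤

/-- `A` has a one-element (trivial) subalgebra. -/
def HasOneElemSub (L : FirstOrder.Language.{u, u}) (A : Type u) [iA : L.Structure A] : Prop :=
  ∃ c : A, ∀ (n : ℕ) (f : L.Functions n), funMap f (fun _ => c) = c

/-- A Kollár class: nontrivial members have no trivial subalgebra. -/
def IsKollar (K : StructClass L) : Prop :=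
  ∀ (M : Type u) [iM : L.Structure M], K M iM → Nontrivial M → ¬ HasOneElemSub L M

/-- `A` is a retract of `B`. -/
def IsRetractOf (L : FirstOrder.Language.{u, u}) (A B : Type u)
    [iA : L.Structure A] [iB : L.Structure B] : Prop :=
  ∃ (g : A →[L] B) (h : B →[L] A), ∀ a : A, h (g a) = a

/-- Validity of an equation in a class. -/
def EqValid (K : StructClass L) (t₁ t₂ : L.Term ℕ) : Prop :=
  ∀ (M : Type u) [iM : L.Structure M], K M iM →
    ∀ v : ℕ → M, t₁.realize v = t₂.realize v

/-- Validity of a quasi-equation (with premise set `Γ`) in a class. -/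
def QEqValid (K : StructClass L) (Γ : Set (L.Term ℕ × L.Term ℕ))
    (t₁ t₂ : L.Term ℕ) : Prop :=
  ∀ (M : Type u) [iM : L.Structure M], K M iM → ∀ v : ℕ → M,
    (∀ p ∈ Γ, Term.realize v p.1 = Term.realize v p.2) →
    t₁.realize v = t₂.realize v

/-- A set of equations is unifiable over `K`. -/
def Unifiable (K : StructClass L) (Γ : Set (L.Term ℕ × L.Term ℕ)) : Prop :=
  ∃ h : ℕ → L.Term ℕ, ∀ p ∈ Γ, EqValid K (p.1.subst h) (p.2.subst h)

/-- No quasi-equation is passive over `K`: every finite set of equations is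
unifiable over `K`. -/
def NoPassiveQEq (K : StructClass L) : Prop :=
  ∀ Γ : Set (L.Term ℕ × L.Term ℕ), Γ.Finite → Unifiable K Γ

/-- The set of variables occurring in a set of equations. -/
def EqnsVars (Γ : Set (L.Term ℕ × L.Term ℕ)) : Set ℕ :=
  ⋃ p ∈ Γ, (↑(p.1.varFinset ∪ p.2.varFinset) : Set ℕ)

/-- `F` is a free `1`-generated algebra for `K`, with free generator `x`. -/
def IsFreeOne (K : StructClass L) (F : Type u) [iF : L.Structure F] (x : F) : Prop :=
  K F iF ∧ Substructure.closure L ({x} : Set F) = ⊤ ∧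
    ∀ (M : Type u) [iM : L.Structure M], K M iM → ∀ m : M,
      ∃ h : F →[L] M, h x = m

/-- A minimal quasivariety. -/
def MinimalQV (K : StructClass L) : Prop :=
  NontrivialClass K ∧ ∀ K' : StructClass L, IsQuasivariety K' → SubClass K' K →
    NontrivialClass K' → EqClass K' K

/-- A trivial class: all members have at most one element. -/
def TrivialClass (K : StructClass L) : Prop :=
  ∀ (M : Type u) [iM : L.Structure M], K M iM → Subsingleton M

/-- The congruence of `A` generated by the pair `(a, b)`. -/
def congGen (L : FirstOrder.Language.{u, u}) (A : Type u) [iA : L.Structure A] (a b : A) : Setoid A :=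
  sInf {θ : Setoid A | IsCong L A θ ∧ θ.r a b}

/-- Equationally definable principal congruences. -/
def HasEDPC (K : StructClass L) : Prop :=
  ∃ S : Finset (L.Term (Fin 4) × L.Term (Fin 4)),
    ∀ (M : Type u) [iM : L.Structure M], K M iM → ∀ a b c d : M,
      ((congGen L M a b).r c d ↔
        ∀ p ∈ S, Term.realize ![a, b, c, d] p.1 = Term.realize ![a, b, c, d] p.2)

/-- A simple algebra: nontrivial, and its only congruences are the identity
and the total relation. -/
def IsSimpleAlg (L : FirstOrder.Language.{u, u}) (A : Type u) [iA : L.Structure A] : Prop :=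
  Nontrivial A ∧ ∀ θ : Setoid A, IsCong L A θ → θ = ⊥ ∨ θ = ⊤

/-- Structural completeness: every subquasivariety generating the same variety
coincides with the class itself. -/
def IsSC (K : StructClass L) : Prop :=
  ∀ K' : StructClass L, IsQuasivariety K' → SubClass K' K →
    EqClass (VGen K') (VGen K) → EqClass K' K


theorem IsEP.exs {n : ℕ} {φ : L.BoundedFormula Empty n} (h : IsEP φ) : IsEP φ.exs := by
  induction n with
  | zero => exact h
  | succ n ih => exact ih h.ex

/-- Existential positive formulas transfer from `A` along a homomorphism into an ultrapower of `B`
to almost all factors. -/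
theorem IsEP.eventually_realize {A B ι : Type u} [L.Structure A] [L.Structure B]
    {uf : Ultrafilter ι} (h : A →[L] ((uf : Filter ι).Product fun _ : ι => B))
    {n : ℕ} {φ : L.BoundedFormula Empty n} (hφ : IsEP φ) {v : Fin n → A} {x : Fin n → ι → B}
    (hx : ∀ j, h (v j) = (x j : (uf : Filter ι).Product fun _ : ι => B))
    (hv : φ.Realize default v) :
    ∀ᶠ i in (uf : Filter ι), φ.Realize default fun j => x j i := by
  have hterm : ∀ {n : ℕ} {v : Fin n → A} {x : Fin n → ι → B},
      (∀ j, h (v j) = (x j : (uf : Filter ι).Product fun _ : ι => B)) →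
      ∀ t : L.Term (Empty ⊕ Fin n), h (t.realize (Sum.elim default v)) =
        ((fun i => t.realize (Sum.elim default fun j => x j i) : ι → B) :
          (uf : Filter ι).Product fun _ : ι => B) := by
    intro n v x hx t
    rw [← HomClass.realize_term]
    have hl : h ∘ Sum.elim default v = fun k =>
        ((Sum.elim (fun e : Empty => e.elim) x k : ι → B) :
          (uf : Filter ι).Product fun _ : ι => B) := by
      funext k
      rcases k with k | k
      · exact k.elim
      · exact hx k
    rw [hl]
    refine (Ultraproduct.term_realize_cast _ t).trans ?_
    congr 1
    funext i
    congr 1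
    funext k
    rcases k with k | k
    · exact k.elim
    · rfl
  induction hφ with
  | equal t₁ t₂ =>
    rw [BoundedFormula.realize_bdEqual] at hv
    have := (hterm hx t₁).symm.trans ((congrArg h hv).trans (hterm hx t₂))
    simpa only [BoundedFormula.realize_bdEqual] using! Quotient.exact this
  | rel R ts =>
    have := HomClass.map_rel h R _ hv
    have he : (h ∘ fun k => (ts k).realize (Sum.elim default v)) = fun k =>
        ((fun i => (ts k).realize (Sum.elim default fun j => x j i) : ι → B) :
          (uf : Filter ι).Product fun _ : ι => B) := funext fun k => hterm hx (ts k)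
    rw [he] at this
    exact
      (relMap_quotient_mk' (s := (uf : Filter ι).productSetoid fun _ => B) R _).1 this
  | sup _ _ ih₁ ih₂ =>
    simp only [BoundedFormula.realize_sup] at hv ⊢
    rcases hv with hv | hv
    · exact (ih₁ hx hv).mono fun _ => Or.inl
    · exact (ih₂ hx hv).mono fun _ => Or.inr
  | inf _ _ ih₁ ih₂ =>
    simp only [BoundedFormula.realize_inf] at hv ⊢
    exact (ih₁ hx hv.1).and (ih₂ hx hv.2)
  | ex _ ih =>
    simp only [BoundedFormula.realize_ex] at hv ⊢
    obtain ⟨a, ha⟩ := hv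
    obtain ⟨y, hy⟩ := Quotient.exists_rep (h a)
    refine (ih (x := Fin.snoc x y) (fun j => ?_) ha).mono fun i hi => ⟨y i, ?_⟩
    · refine Fin.lastCases ?_ (fun j => ?_) j
      · simpa using! hy.symm
      · simpa using hx j
    · convert! hi using 1
      funext j
      refine Fin.lastCases ?_ (fun j => ?_) j <;> simp

/-- A property `Q` of maps `A → B` is enforced by an existential positive type of `A` over `D` if,
for each enumeration `e` of elements including `D`, it follows from an existential positive
formula satisfied by `e`. -/
def EnforcedBy (L : FirstOrder.Language.{u, u}) {A B : Type u} [L.Structure A] [L.Structure B]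
    (Q : (A → B) → Prop) (D : Finset A) : Prop :=
  ∀ (n : ℕ) (e : Fin n → A), (∀ a ∈ D, ∃ j, e j = a) →
    ∃ φ : L.BoundedFormula Empty n, IsEP φ ∧ φ.Realize default e ∧
      ∀ g : A → B, φ.Realize default (g ∘ e) → Q g

section

variable {A B : Type u} [L.Structure A] [L.Structure B]

theorem enforcedBy_map_fun [DecidableEq A] {n : ℕ} (f : L.Functions n) (x : Fin n → A) :
    EnforcedBy L (fun g : A → B => g (funMap f x) = funMap f (g ∘ x))
      (insert (funMap f x) (Finset.univ.image x)) := by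
  intro m e he
  obtain ⟨k, hk⟩ := he _ (Finset.mem_insert_self _ _)
  choose r hr using fun i => he (x i)
    (Finset.mem_insert_of_mem (Finset.mem_image_of_mem x (Finset.mem_univ i)))
  refine ⟨(Term.var (Sum.inr k)).bdEqual (Term.func f fun i => Term.var (Sum.inr (r i))),
    .equal _ _, ?_, fun g hg => ?_⟩
  · simp [BoundedFormula.realize_bdEqual, hk, hr]
  · simpa [BoundedFormula.realize_bdEqual, hk, hr, Function.comp_def] using hg

theorem enforcedBy_map_rel [DecidableEq A] {n : ℕ} (R : L.Relations n) (x : Fin n → A)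
    (hR : RelMap R x) :
    EnforcedBy L (fun g : A → B => RelMap R (g ∘ x)) (Finset.univ.image x) := by
  intro m e he
  choose r hr using fun i => he (x i) (Finset.mem_image_of_mem x (Finset.mem_univ i))
  refine ⟨BoundedFormula.rel R fun i => Term.var (Sum.inr (r i)), .rel _ _, ?_, fun g hg => ?_⟩
  · simpa [BoundedFormula.Realize, hr] using hR
  · simpa [BoundedFormula.Realize, hr, Function.comp_def] using hg

theorem EnforcedBy.and [DecidableEq A] {Q₁ Q₂ : (A → B) → Prop} {D₁ D₂ : Finset A}
    (h₁ : EnforcedBy L Q₁ D₁) (h₂ : EnforcedBy L Q₂ D₂) :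
    EnforcedBy L (fun g => Q₁ g ∧ Q₂ g) (D₁ ∪ D₂) := by
  intro n e he
  obtain ⟨φ, hφ, hφe, hφQ⟩ := h₁ n e fun a ha => he a (Finset.mem_union_left _ ha)
  obtain ⟨ψ, hψ, hψe, hψQ⟩ := h₂ n e fun a ha => he a (Finset.mem_union_right _ ha)
  refine ⟨φ ⊓ ψ, hφ.inf hψ, BoundedFormula.realize_inf.2 ⟨hφe, hψe⟩, fun g hg => ?_⟩
  rw [BoundedFormula.realize_inf] at hg
  exact ⟨hφQ g hg.1, hψQ g hg.2⟩

theorem exists_enforcedBy_forall_mem {C : Type*} {Q : C → (A → B) → Prop}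
    (h : ∀ c, ∃ D, EnforcedBy L (Q c) D) {S : Finset C} (hS : S.Nonempty) :
    ∃ D, EnforcedBy L (fun g => ∀ c ∈ S, Q c g) D := by
  classical
  induction hS using Finset.Nonempty.cons_induction with
  | singleton c => simpa using h c
  | cons c S hc hS ih =>
    obtain ⟨D₁, h₁⟩ := h c
    obtain ⟨D₂, h₂⟩ := ih
    exact ⟨D₁ ∪ D₂, by simpa using h₁.and h₂⟩

theorem nonempty_fun_of_forall_isEP (h : ∀ φ : L.Sentence, IsEP φ → A ⊨ φ → B ⊨ φ) :
    Nonempty (A → B) := by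
  rcases isEmpty_or_nonempty A with hA | ⟨⟨a⟩⟩
  · exact ⟨hA.elim⟩
  · let φ : L.BoundedFormula Empty 1 := (Term.var (Sum.inr 0)).bdEqual (Term.var (Sum.inr 0))
    have hB : B ⊨ (φ.exs : L.Sentence) :=
      h φ.exs (IsEP.equal _ _).exs (BoundedFormula.realize_exs.2 ⟨fun _ => a, by simp [φ]⟩)
    obtain ⟨b, -⟩ := BoundedFormula.realize_exs.1 hB
    exact ⟨fun _ => b 0⟩

theorem EnforcedBy.exists_fun {Q : (A → B) → Prop} {D : Finset A} (hQ : EnforcedBy L Q D)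
    (h : ∀ φ : L.Sentence, IsEP φ → A ⊨ φ → B ⊨ φ) : ∃ g, Q g := by
  obtain ⟨g₀⟩ := nonempty_fun_of_forall_isEP h
  let e : Fin D.card → A := fun j => D.equivFin.symm j
  have he : Function.Injective e := Subtype.val_injective.comp D.equivFin.symm.injective
  obtain ⟨φ, hφ, hφe, hφQ⟩ := hQ _ e fun a ha => ⟨D.equivFin ⟨a, ha⟩, by simp [e]⟩
  obtain ⟨b, hb⟩ := BoundedFormula.realize_exs.1
    (h φ.exs hφ.exs (BoundedFormula.realize_exs.2 ⟨e, hφe⟩))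
  exact ⟨Function.extend e b g₀, hφQ _ (by rwa [Function.extend_comp he])⟩

/-- If each finite subfamily of `Q` is satisfied by a map, then some ultrafilter and some family of
maps satisfy each member of `Q` almost everywhere. -/
theorem exists_ultrafilter_eventually {C X : Type u} {Q : C → X → Prop}
    (h : ∀ S : Finset C, ∃ g, ∀ c ∈ S, Q c g) :
    ∃ (ι : Type u) (uf : Ultrafilter ι) (G : ι → X), ∀ c, ∀ᶠ i in (uf : Filter ι), Q c (G i) := by
  choose G hG using h
  refine ⟨Finset C, Ultrafilter.of Filter.atTop, G, fun c => ?_⟩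
  refine Ultrafilter.of_le Filter.atTop ?_
  filter_upwards [Filter.eventually_ge_atTop ({c} : Finset C)] with S hS
  exact hG S c (hS (Finset.mem_singleton_self c))

theorem mapsIntoUltrapower_of_forall_isEP (h : ∀ φ : L.Sentence, IsEP φ → A ⊨ φ → B ⊨ φ) :
    MapsIntoUltrapower L A B := by
  classical
  let C : Type u := (Σ n, L.Functions n × (Fin n → A)) ⊕
    (Σ n, {p : L.Relations n × (Fin n → A) // RelMap p.1 p.2})
  let Q : C → (A → B) → Prop := Sum.elim
    (fun c g => g (funMap c.2.1 c.2.2) = funMap c.2.1 (g ∘ c.2.2))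
    (fun c g => RelMap c.2.1.1 (g ∘ c.2.1.2))
  have hQ : ∀ c, ∃ D, EnforcedBy L (Q c) D := by
    rintro (⟨n, f, x⟩ | ⟨n, ⟨R, x⟩, hR⟩)
    · exact ⟨_, enforcedBy_map_fun f x⟩
    · exact ⟨_, enforcedBy_map_rel R x hR⟩
  have hfin : ∀ S : Finset C, ∃ g, ∀ c ∈ S, Q c g := by
    intro S
    rcases S.eq_empty_or_nonempty with rfl | hS
    · obtain ⟨g⟩ := nonempty_fun_of_forall_isEP h
      exact ⟨g, by simp⟩
    · obtain ⟨D, hD⟩ := exists_enforcedBy_forall_mem hQ hS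
      exact hD.exists_fun h
  obtain ⟨ι, uf, G, hG⟩ := exists_ultrafilter_eventually hfin
  refine ⟨ι, uf, ⟨{ toFun := fun a => ((fun i => G i a : ι → B) :
    (uf : Filter ι).Product fun _ : ι => B), map_fun' := ?_, map_rel' := ?_ }⟩⟩
  · intro n f x
    refine Eq.trans ?_ (Ultraproduct.funMap_cast f fun k i => G i (x k)).symm
    exact Quotient.sound (hG (Sum.inl ⟨n, f, x⟩))
  · intro n R x hR
    exact (relMap_quotient_mk' (s := (uf : Filter ι).productSetoid fun _ => B) R
      fun k i => G i (x k)).2 (hG (Sum.inr ⟨n, ⟨R, x⟩, hR⟩))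

end

/-- `B` satisfies every existential positive sentence true in `A`
iff there is a homomorphism from `A` into an ultrapower of `B`. -/
theorem statement_0 (L : FirstOrder.Language.{u, u}) (A B : Type u)
    [iA : L.Structure A] [iB : L.Structure B] :
    (∀ φ : L.Sentence, IsEP φ → A ⊨ φ → B ⊨ φ) ↔ MapsIntoUltrapower L A B := by
  refine ⟨mapsIntoUltrapower_of_forall_isEP, ?_⟩
  rintro ⟨ι, uf, ⟨h⟩⟩ φ hφ hA
  obtain ⟨i, hi⟩ := (hφ.eventually_realize h (x := fun j => j.elim0) (fun j => j.elim0) hA).exists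
  rwa [Subsingleton.elim (fun j : Fin 0 => _) default] at hi

end Paper
end

section
/- For a quasivariety K, the following are equivalent: (i) all nontrivial members of K satisfy exactly the same existential positive sentences; (ii) for any two nontrivial members A and B of K, there is a homomorphism from A into some ultrapower of B (and, symmetrically, from B into some ultrapower of A). -/
universe u

open FirstOrder Language Structure

namespace Paper

variable {L : FirstOrder.Language.{u, u}}

/-- Existential positive formulas are preserved by homomorphisms. -/
theorem IsEP.realize_hom {A B : Type u} [L.Structure A] [L.Structure B] (h : A →[L] B) {n : ℕ}
    {φ : L.BoundedFormula Empty n} (hφ : IsEP φ) {v : Empty → A} {w : Empty → B}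
    {xs : Fin n → A} (hx : φ.Realize v xs) : φ.Realize w (h ∘ xs) := by
  have key {k : ℕ} (xs : Fin k → A) : Sum.elim w (h ∘ xs) = h ∘ Sum.elim v xs := by
    rw [Sum.comp_elim, Subsingleton.elim w (h ∘ v)]
  induction hφ with
  | equal t₁ t₂ =>
    rw [BoundedFormula.realize_bdEqual] at hx ⊢
    rw [key, HomClass.realize_term, HomClass.realize_term, hx]
  | rel R ts =>
    simp only [BoundedFormula.Realize] at hx ⊢
    simp only [key, HomClass.realize_term]
    exact h.map_rel R _ hx
  | sup _ _ ih₁ ih₂ =>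
    rw [BoundedFormula.realize_sup] at hx ⊢
    exact hx.imp ih₁ ih₂
  | inf _ _ ih₁ ih₂ =>
    rw [BoundedFormula.realize_inf] at hx ⊢
    exact hx.imp ih₁ ih₂
  | ex _ ih =>
    rw [BoundedFormula.realize_ex] at hx ⊢
    obtain ⟨a, ha⟩ := hx
    refine ⟨h a, ?_⟩
    rw [← Fin.comp_snoc]
    exact ih ha

theorem MapsIntoUltrapower.realize_of_isEP {A B : Type u} [L.Structure A] [L.Structure B]
    [Nonempty B] (h : MapsIntoUltrapower L A B) {φ : L.Sentence} (hφ : IsEP φ) (hA : A ⊨ φ) :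
    B ⊨ φ := by
  obtain ⟨ι, uf, ⟨g⟩⟩ := h
  have hP : ((uf : Filter ι).Product fun _ : ι => B) ⊨ φ := by
    have := hφ.realize_hom g (w := default) hA
    rwa [Subsingleton.elim (g ∘ default) default] at this
  rw [Ultraproduct.sentence_realize] at hP
  exact hP.exists.choose_spec

/-- The facts a homomorphism out of `A` has to preserve: values of the basic operations and
instances of the basic relations. -/
inductive AtomicFact (L : FirstOrder.Language.{u, u}) (A : Type u) [L.Structure A] : Type u
  | func {n : ℕ} (f : L.Functions n) (x : Fin n → A)
  | rel {n : ℕ} (r : L.Relations n) (x : Fin n → A) (h : RelMap r x)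

namespace AtomicFact

variable {A B : Type u} [L.Structure A] [L.Structure B]

/-- The elements of `A` occurring in a fact. -/
def support : AtomicFact L A → Set A
  | func f x => insert (funMap f x) (Set.range x)
  | rel _ x _ => Set.range x

theorem finite_support (d : AtomicFact L A) : d.support.Finite := by
  cases d with
  | func f x => exact (Set.finite_range x).insert _
  | rel r x h => exact Set.finite_range x

/-- The map `g` preserves a given fact of `A`. -/
def PreservedBy (g : A → B) : AtomicFact L A → Prop
  | func f x => g (funMap f x) = funMap f (g ∘ x)
  | rel r x _ => RelMap r (g ∘ x)

/-- The fact rewritten as an atomic formula, with the elements of `A` replaced by variables. -/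
def toFormula {n : ℕ} (idx : A → Fin n) : AtomicFact L A → L.BoundedFormula Empty n
  | func f x => (Term.var (Sum.inr (idx (funMap f x)))).bdEqual
      (Term.func f fun i => Term.var (Sum.inr (idx (x i))))
  | rel r x _ => BoundedFormula.rel r fun i => Term.var (Sum.inr (idx (x i)))

theorem isEP_toFormula {n : ℕ} (idx : A → Fin n) (d : AtomicFact L A) :
    IsEP (d.toFormula idx) := by
  cases d with
  | func f x => exact .equal _ _
  | rel r x h => exact .rel _ _

theorem realize_toFormula {n : ℕ} (idx : A → Fin n) (d : AtomicFact L A) {v : Empty → B}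
    {xs : Fin n → B} : (d.toFormula idx).Realize v xs ↔ d.PreservedBy (xs ∘ idx) := by
  cases d <;> rfl

theorem preservedBy_of_eqOn_id {g : A → A} {d : AtomicFact L A}
    (h : ∀ a ∈ d.support, g a = a) : d.PreservedBy g := by
  cases d with
  | func f x =>
    have hx : g ∘ x = x := funext fun i => h _ (Set.mem_insert_of_mem _ ⟨i, rfl⟩)
    exact (h _ (Set.mem_insert _ _)).trans (by rw [hx])
  | rel r x hr =>
    have hx : g ∘ x = x := funext fun i => h _ ⟨i, rfl⟩
    exact (congrArg (RelMap r) hx).mpr hr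

theorem exists_isEP_formula {n : ℕ} [NeZero n] (idx : A → Fin n) (s : Finset (AtomicFact L A)) :
    ∃ φ : L.BoundedFormula Empty n, IsEP φ ∧
      ∀ (M : Type u) [L.Structure M] (v : Empty → M) (xs : Fin n → M),
        φ.Realize v xs ↔ ∀ d ∈ s, d.PreservedBy (xs ∘ idx) := by
  classical
  induction s using Finset.induction_on with
  | empty =>
    refine ⟨_, .equal (Term.var (Sum.inr 0)) (Term.var (Sum.inr 0)), ?_⟩
    simp [BoundedFormula.realize_bdEqual]
  | insert d s _ ih =>
    obtain ⟨φ, hφ, h⟩ := ih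
    refine ⟨_, .inf (d.isEP_toFormula idx) hφ, fun M _ v xs => ?_⟩
    rw [BoundedFormula.realize_inf, realize_toFormula, h, Finset.forall_mem_insert]

theorem exists_map_preserving [Nonempty A]
    (hAB : ∀ φ : L.Sentence, IsEP φ → A ⊨ φ → B ⊨ φ) (s : Finset (AtomicFact L A)) :
    ∃ g : A → B, ∀ d ∈ s, d.PreservedBy g := by
  classical
  have hfin : (⋃ d ∈ s, d.support).Finite :=
    s.finite_toSet.biUnion fun d _ => d.finite_support
  let a₀ : A := Classical.arbitrary A
  let S : Finset A := insert a₀ hfin.toFinset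
  have ha₀ : a₀ ∈ S := Finset.mem_insert_self _ _
  have : NeZero S.card := ⟨Finset.card_ne_zero_of_mem ha₀⟩
  let idx : A → Fin S.card := fun a => if h : a ∈ S then S.equivFin ⟨a, h⟩ else 0
  let e : Fin S.card → A := fun i => S.equivFin.symm i
  have he : ∀ a ∈ S, e (idx a) = a := fun a ha => by simp [e, idx, ha]
  obtain ⟨φ, hφ, h⟩ := exists_isEP_formula idx s
  have hA : A ⊨ φ.exs := BoundedFormula.realize_exs.2 ⟨e, (h A _ _).2 fun d hd =>
    preservedBy_of_eqOn_id fun a ha => he a <| Finset.mem_insert_of_mem <|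
      hfin.mem_toFinset.2 <| Set.mem_biUnion hd ha⟩
  obtain ⟨xs, hxs⟩ := BoundedFormula.realize_exs.1 (hAB _ hφ.exs hA)
  exact ⟨xs ∘ idx, (h B _ _).1 hxs⟩

end AtomicFact

theorem mapsIntoUltrapower_of_isEP {A B : Type u} [L.Structure A] [L.Structure B] [Nonempty A]
    (hAB : ∀ φ : L.Sentence, IsEP φ → A ⊨ φ → B ⊨ φ) : MapsIntoUltrapower L A B := by
  classical
  choose g hg using AtomicFact.exists_map_preserving hAB
  let uf : Ultrafilter (Finset (AtomicFact L A)) := Ultrafilter.of Filter.atTop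
  have huf (d : AtomicFact L A) : ∀ᶠ s in (uf : Filter _), d.PreservedBy (g s) := by
    refine Ultrafilter.of_le Filter.atTop ?_
    filter_upwards [Filter.eventually_ge_atTop {d}] with s hs
    exact hg s d (hs (Finset.mem_singleton_self d))
  refine ⟨_, uf, ⟨⟨fun a => Quotient.mk _ fun s => g s a, fun f x => ?_, fun r x hr => ?_⟩⟩⟩
  · exact (Quotient.sound (huf (.func f x))).trans
      (Ultraproduct.funMap_cast (u := uf) f fun i s => g s (x i)).symm
  · exact (relMap_quotient_mk' ((uf : Filter _).productSetoid fun _ => B) r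
      fun i s => g s (x i)).2 (huf (.rel r x hr))

/-- for a quasivariety `K`, all nontrivial members satisfy the same
existential positive sentences iff any two nontrivial members map
homomorphically into ultrapowers of each other. -/
theorem statement_1 (L : FirstOrder.Language.{u, u}) (K : StructClass L)
    (hK : IsQuasivariety K) :
    (∀ (A : Type u) [iA : L.Structure A] (B : Type u) [iB : L.Structure B],
        K A iA → K B iB → Nontrivial A → Nontrivial B →
        ∀ φ : L.Sentence, IsEP φ → (A ⊨ φ ↔ B ⊨ φ)) ↔
      (∀ (A : Type u) [iA : L.Structure A] (B : Type u) [iB : L.Structure B],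
        K A iA → K B iB → Nontrivial A → Nontrivial B →
        MapsIntoUltrapower L A B ∧ MapsIntoUltrapower L B A) := by
  refine ⟨fun h A iA B iB hA hB nA nB => ?_, fun h A iA B iB hA hB nA nB φ hφ => ?_⟩
  · have hAB := h A B hA hB nA nB
    exact ⟨mapsIntoUltrapower_of_isEP fun φ hφ => (hAB φ hφ).1,
      mapsIntoUltrapower_of_isEP fun φ hφ => (hAB φ hφ).2⟩
  · obtain ⟨hAB, hBA⟩ := h A B hA hB nA nB
    exact ⟨hAB.realize_of_isEP hφ, hBA.realize_of_isEP hφ⟩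

end Paper
end

section
/- Let K be a quasivariety such that for any two relatively subdirectly irreducible members A, B of K there exists C ∈ K into which both A and B embed. Then K has the joint embedding property. -/
universe u

open FirstOrder Language Structure

namespace Paper

variable {L : FirstOrder.Language.{u, u}}

/-- The atomic formulas with parameters in `A`: equalities of two elements, and relation
symbols applied to tuples of elements. -/
def Atom (L : FirstOrder.Language.{u, u}) (A : Type u) : Type u :=
  (A × A) ⊕ (Σ n, L.Relations n × (Fin n → A))

/-- The atomic formulas over `A` that hold in `B` along a homomorphism. -/
def kernel {A B : Type u} [L.Structure A] [L.Structure B] (f : A →[L] B) : Set (Atom L A) :=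
  fun p => Sum.rec (fun q => f q.1 = f q.2) (fun q => RelMap q.2.1 (f ∘ q.2.2)) p

theorem inl_mem_kernel {A B : Type u} [L.Structure A] [L.Structure B] (f : A →[L] B) (a b : A) :
    (Sum.inl (a, b) : Atom L A) ∈ kernel f ↔ f a = f b :=
  Iff.rfl

theorem inr_mem_kernel {A B : Type u} [L.Structure A] [L.Structure B] (f : A →[L] B)
    {n : ℕ} (R : L.Relations n) (x : Fin n → A) :
    (Sum.inr ⟨n, R, x⟩ : Atom L A) ∈ kernel f ↔ RelMap R (f ∘ x) :=
  Iff.rfl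

theorem kernel_subset_kernel_comp {A B C : Type u} [L.Structure A] [L.Structure B]
    [L.Structure C] (g : B →[L] C) (f : A →[L] B) : kernel f ⊆ kernel (g.comp f) := by
  rintro (⟨a, b⟩ | ⟨n, R, x⟩) hp
  · exact congrArg g hp
  · exact g.map_rel R (f ∘ x) hp

theorem kernel_embedding_comp {A B C : Type u} [L.Structure A] [L.Structure B]
    [L.Structure C] (g : B ↪[L] C) (f : A →[L] B) : kernel (g.toHom.comp f) = kernel f := by
  ext p
  rcases p with ⟨a, b⟩ | ⟨n, R, x⟩
  · exact g.injective.eq_iff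
  · exact g.map_rel R (f ∘ x)

/-- A homomorphism that preserves the falsity of atomic formulas is an embedding. -/
def embeddingOfKernel {A B : Type u} [L.Structure A] [L.Structure B] (f : A →[L] B)
    (hf : kernel f ⊆ kernel (Hom.id L A)) : A ↪[L] B where
  toFun := f
  inj' a b hab := hf ((inl_mem_kernel f a b).2 hab)
  map_fun' g x := f.map_fun g x
  map_rel' R x := ⟨fun hx => hf ((inr_mem_kernel f R x).2 hx), fun hx => f.map_rel R x hx⟩

/-- The homomorphism into a product given by its components. -/
def piHom {ι A : Type u} {M : ι → Type u} [L.Structure A] [∀ i, L.Structure (M i)]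
    (f : ∀ i, A →[L] M i) :
    @FirstOrder.Language.Hom L A (∀ i, M i) _ (piStructure M) :=
  letI := piStructure (L := L) M
  { toFun := fun a i => f i a
    map_fun' := fun g x => funext fun i => (f i).map_fun g x
    map_rel' := fun R x hx i => (f i).map_rel R x hx }

/-- The projection of a product onto a factor. -/
def projHom {ι : Type u} (M : ι → Type u) [∀ i, L.Structure (M i)] (i : ι) :
    @FirstOrder.Language.Hom L (∀ i, M i) (M i) (piStructure M) _ :=
  letI := piStructure (L := L) M
  { toFun := fun x => x i
    map_fun' := fun _ _ => rfl
    map_rel' := fun _ _ hx => hx i }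

theorem mem_kernel_pi {ι A : Type u} {M : ι → Type u} [L.Structure A] [∀ i, L.Structure (M i)]
    (f : @FirstOrder.Language.Hom L A (∀ i, M i) _ (piStructure M)) (p : Atom L A) :
    p ∈ @kernel L A (∀ i, M i) _ (piStructure M) f ↔
      ∀ i, p ∈ kernel (@Hom.comp L A (∀ i, M i) _ (piStructure M) (M i) _ (projHom M i) f) := by
  let := piStructure (L := L) M
  rcases p with ⟨a, b⟩ | ⟨n, R, x⟩
  · exact funext_iff
  · exact Iff.rfl

/-- The homomorphism into an ultraproduct given by its components. -/
def ultraproductHom {ι A : Type u} {M : ι → Type u} [L.Structure A] [∀ i, L.Structure (M i)]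
    (uf : Ultrafilter ι) (f : ∀ i, A →[L] M i) : A →[L] (uf : Filter ι).Product M where
  toFun a := ((fun i => f i a : ∀ i, M i) : (uf : Filter ι).Product M)
  map_fun' g x := by
    refine Eq.trans ?_ (Ultraproduct.funMap_cast g fun j i => f i (x j)).symm
    exact congrArg _ (funext fun i => (f i).map_fun g x)
  map_rel' R x hx :=
    (relMap_quotient_mk' (s := (uf : Filter ι).productSetoid M) R fun j i => f i (x j)).2
      (Filter.Eventually.of_forall fun i => (f i).map_rel R x hx)

theorem mem_kernel_ultraproductHom {ι A : Type u} {M : ι → Type u} [L.Structure A]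
    [∀ i, L.Structure (M i)] (uf : Ultrafilter ι) (f : ∀ i, A →[L] M i) (p : Atom L A) :
    p ∈ kernel (ultraproductHom uf f) ↔ ∀ᶠ i in (uf : Filter ι), p ∈ kernel (f i) := by
  rcases p with ⟨a, b⟩ | ⟨n, R, x⟩
  · exact Quotient.eq''
  · exact relMap_quotient_mk' (s := (uf : Filter ι).productSetoid M) R fun j i => f i (x j)

/-- The kernels of homomorphisms from `A` to members of `K` that omit `p`. -/
def kernelsOmitting (K : StructClass L) (A : Type u) [L.Structure A] (p : Atom L A) :
    Set (Set (Atom L A)) :=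
  {T | p ∉ T ∧ ∃ (M : Type u) (iM : L.Structure M), K M iM ∧ ∃ f : A →[L] M, kernel f = T}

theorem exists_upper_bound_kernelsOmitting {K : StructClass L} (hK : IsQuasivariety K)
    {A : Type u} [L.Structure A] {p : Atom L A} {c : Set (Set (Atom L A))}
    (hcK : c ⊆ kernelsOmitting K A p) (hc : IsChain (· ⊆ ·) c) (hne : c.Nonempty) :
    ∃ T ∈ kernelsOmitting K A p, ∀ s ∈ c, s ⊆ T := by
  have : Nonempty c := hne.to_subtype
  have : IsDirectedOrder c := ⟨fun a b => (hc.total a.2 b.2).elim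
    (fun hab => ⟨b, hab, le_rfl⟩) fun hba => ⟨a, le_rfl, hba⟩⟩
  choose M iM hM f hf using fun s : c => (hcK s.2).2
  let uf : Ultrafilter c := Ultrafilter.of Filter.atTop
  refine ⟨kernel (ultraproductHom uf f), ⟨?_, _, _, hK.ultra_closed c M uf hM, _, rfl⟩, ?_⟩
  · rw [mem_kernel_ultraproductHom]
    intro hp
    obtain ⟨s, hs⟩ := hp.exists
    exact (hcK s.2).1 (hf s ▸ hs)
  · intro s hs q hq
    rw [mem_kernel_ultraproductHom]
    filter_upwards [Ultrafilter.of_le Filter.atTop (Filter.Ici_mem_atTop (⟨s, hs⟩ : c))] with t ht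
    rw [hf t]
    exact ht hq

/-- Every atomic formula that fails in a member of a quasivariety also fails in some
relatively subdirectly irreducible homomorphic image. -/
theorem exists_relSDI_notMem_kernel {K : StructClass L} (hK : IsQuasivariety K)
    {A : Type u} [iA : L.Structure A] (hA : K A iA) {p : Atom L A}
    (hp : p ∉ kernel (Hom.id L A)) :
    ∃ (B : Type u) (_ : L.Structure B), RelSDI K B ∧ ∃ f : A →[L] B, p ∉ kernel f := by
  obtain ⟨T, -, ⟨hpT, M, iM, hM, f, rfl⟩, hmax⟩ := zorn_subset_nonempty (kernelsOmitting K A p)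
    (fun c hcK hc hne => exists_upper_bound_kernelsOmitting hK hcK hc hne) _
    ⟨hp, A, iA, hA, _, rfl⟩
  let g : A →[L] f.range := f.codRestrict f.range f.mem_range_self
  have hg : kernel g = kernel f := (kernel_embedding_comp f.range.subtype g).symm
  have hgs : Function.Surjective g := by
    rintro ⟨_, a, rfl⟩
    exact ⟨a, rfl⟩
  refine ⟨f.range, inferInstance, ⟨hK.sub_closed _ M ⟨f.range.subtype⟩ hM, ?_⟩, g, hg ▸ hpT⟩
  intro ι N iN hN h hsurj
  let := piStructure (L := L) N
  have hk : kernel (h.toHom.comp g) = kernel f := (kernel_embedding_comp h g).trans hg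
  obtain ⟨i, hi⟩ : ∃ i, p ∉ kernel ((projHom N i).comp (h.toHom.comp g)) := by
    by_contra! hall
    exact hpT (hk ▸ (mem_kernel_pi _ p).2 hall)
  refine ⟨i, ?_, hsurj i⟩
  have hle : kernel ((projHom N i).comp (h.toHom.comp g)) ⊆ kernel f :=
    hmax ⟨hi, N i, iN i, hN i, _, rfl⟩ (hk ▸ kernel_subset_kernel_comp _ _)
  intro x y hxy
  obtain ⟨a, rfl⟩ := hgs x
  obtain ⟨b, rfl⟩ := hgs y
  have hab : (Sum.inl (a, b) : Atom L A) ∈ kernel g := hg ▸ hle hxy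
  exact hab

/-- A family of homomorphisms refuting every atomic formula that fails in `A` yields an embedding
of `A` into the product. -/
theorem nonempty_embedding_pi {ι A : Type u} {M : ι → Type u} [L.Structure A]
    [∀ i, L.Structure (M i)] (f : ∀ i, A →[L] M i)
    (hf : ∀ p, p ∉ kernel (Hom.id L A) → ∃ i, p ∉ kernel (f i)) :
    Nonempty (@FirstOrder.Language.Embedding L A (∀ i, M i) _ (piStructure M)) := by
  let := piStructure (L := L) M
  refine ⟨embeddingOfKernel (piHom f) fun p hp => ?_⟩
  by_contra hpA
  obtain ⟨i, hi⟩ := hf p hpA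
  exact hi ((mem_kernel_pi (piHom f) p).1 hp i)

theorem exists_notMem_kernel_id (A : Type u) [L.Structure A] [Nontrivial A] :
    ∃ p : Atom L A, p ∉ kernel (Hom.id L A) := by
  obtain ⟨a, b, hab⟩ := exists_pair_ne A
  exact ⟨Sum.inl (a, b), hab⟩

/-- if any two relatively subdirectly irreducible members of a
quasivariety `K` embed into a common member of `K`, then `K` has the JEP. -/
theorem statement_3 (L : FirstOrder.Language.{u, u}) (K : StructClass L)
    (hK : IsQuasivariety K)
    (h : ∀ (A : Type u) [iA : L.Structure A] (B : Type u) [iB : L.Structure B],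
      RelSDI K A → RelSDI K B →
      ∃ (C : Type u) (iC : L.Structure C), K C iC ∧
        Nonempty (@FirstOrder.Language.Embedding L A C iA iC) ∧
        Nonempty (@FirstOrder.Language.Embedding L B C iB iC)) :
    HasJEP K := by
  intro A iA B iB hA hB _ _
  choose M iM hM f hf using fun p : {p : Atom L A // p ∉ kernel (Hom.id L A)} =>
    exists_relSDI_notMem_kernel hK hA p.2
  choose N iN hN g hg using fun q : {q : Atom L B // q ∉ kernel (Hom.id L B)} =>
    exists_relSDI_notMem_kernel hK hB q.2
  choose C iC hC hMC hNC using fun i : {p : Atom L A // p ∉ kernel (Hom.id L A)} ×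
    {q : Atom L B // q ∉ kernel (Hom.id L B)} => h (M i.1) (N i.2) (hM i.1) (hN i.2)
  obtain ⟨p₀, hp₀⟩ := exists_notMem_kernel_id (L := L) A
  obtain ⟨q₀, hq₀⟩ := exists_notMem_kernel_id (L := L) B
  refine ⟨∀ i, C i, piStructure C, hK.prod_closed _ C hC, ?_, ?_⟩
  · refine nonempty_embedding_pi (fun i => (hMC i).some.toHom.comp (f i.1)) fun p hp =>
      ⟨(⟨p, hp⟩, ⟨q₀, hq₀⟩), ?_⟩
    rw [kernel_embedding_comp]
    exact hf ⟨p, hp⟩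
  · refine nonempty_embedding_pi (fun i => (hNC i).some.toHom.comp (g i.2)) fun q hq =>
      ⟨(⟨p₀, hp₀⟩, ⟨q, hq⟩), ?_⟩
    rw [kernel_embedding_comp]
    exact hg ⟨q, hq⟩

end Paper
end

section
/- Let A be a nontrivial member of an algebraic quasivariety K. (i) If the total relation A×A is a compact element of the lattice Con_K A of K-congruences of A, then A has a homomorphic image in K that is K-simple. (ii) If A is finitely generated and of finite type, then A×A is compact in Con_K A, and hence A has a K-simple homomorphic image in K. -/
universe u

open FirstOrder Language Structure

namespace Paper

variable {L : FirstOrder.Language.{u, u}}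

/-- In an algebraic language, the quotient map by a congruence is a homomorphism. -/
def quotHom [L.IsAlgebraic] (A : Type u) [iA : L.Structure A] (θ : Setoid A)
    (h : IsCong L A θ) :
    @FirstOrder.Language.Hom L A (Quotient θ) iA (quotStructure L A θ h) :=
  let := congPrestructure L A θ h
  let := quotStructure L A θ h
  { toFun := Quotient.mk θ
    map_fun' := fun f x => (funMap_quotient_mk' θ f x).symm
    map_rel' := fun r _ => isEmptyElim r }

theorem isCong_ker [L.IsAlgebraic] {A B : Type u} [L.Structure A] [L.Structure B]
    (h : A →[L] B) : IsCong L A (Setoid.ker h) := by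
  refine ⟨fun n f x y hxy => ?_, fun n r => isEmptyElim r⟩
  change h _ = h _
  rw [h.map_fun, h.map_fun]
  congr 1
  exact funext hxy

theorem isKCong_ker [L.IsAlgebraic] {K : StructClass L} (hK : IsQuasivariety K)
    {A B : Type u} [iA : L.Structure A] [iB : L.Structure B] (hB : K B iB)
    (h : A →[L] B) : IsKCong K A (Setoid.ker h) := by
  refine ⟨isCong_ker h, ?_⟩
  let := congPrestructure L A (Setoid.ker h) (isCong_ker h)
  let := quotStructure L A (Setoid.ker h) (isCong_ker h)
  refine hK.sub_closed (Quotient (Setoid.ker h)) B ⟨?_⟩ hB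
  refine { toFun := Quotient.lift h fun _ _ hab => hab
           inj' := ?_
           map_fun' := ?_
           map_rel' := fun r => isEmptyElim r }
  · rintro ⟨a⟩ ⟨b⟩ hab
    exact Quotient.sound hab
  · intro n f x
    obtain ⟨y, rfl⟩ : ∃ y : Fin n → A, (fun i => Quotient.mk (Setoid.ker h) (y i)) = x :=
      ⟨fun i => (x i).out, funext fun i => Quotient.out_eq _⟩
    have e := funMap_quotient_mk' (Setoid.ker h) f y
    exact (congrArg (Quotient.lift h fun _ _ hab => hab) e).trans (h.map_fun f y)

/-- The ultralimit of a family of `K`-congruences is a `K`-congruence. -/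
theorem exists_isKCong_ultralimit [L.IsAlgebraic] {K : StructClass L} (hK : IsQuasivariety K)
    {A : Type u} [iA : L.Structure A] {ι : Type u} (U : Ultrafilter ι)
    (θ : ι → Setoid A) (hθ : ∀ i, IsKCong K A (θ i)) :
    ∃ σ : Setoid A, IsKCong K A σ ∧ ∀ a b, σ a b ↔ ∀ᶠ i in (U : Filter ι), θ i a b := by
  let inst : ∀ i, L.Structure (Quotient (θ i)) := fun i =>
    quotStructure L A (θ i) (hθ i).choose
  let g : A →[L] (U : Filter ι).Product fun i => Quotient (θ i) :=
    { toFun := fun a => ((fun i => Quotient.mk (θ i) a : ∀ i, Quotient (θ i)) :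
        (U : Filter ι).Product fun i => Quotient (θ i))
      map_fun' := fun f x => by
        refine Eq.trans ?_ (Ultraproduct.funMap_cast (u := U) f
          (fun j i => Quotient.mk (θ i) (x j))).symm
        congr 1
        funext i
        exact (quotHom A (θ i) (hθ i).choose).map_fun f x
      map_rel' := fun r => isEmptyElim r }
  refine ⟨Setoid.ker g, isKCong_ker hK
    (hK.ultra_closed ι _ U fun i => (hθ i).choose_spec) g, fun a b => ?_⟩
  refine Quotient.eq.trans (Filter.eventually_congr (.of_forall fun i => ?_))
  exact Quotient.eq

/-- A member of `K` whose total relation is compact among `K`-congruences has a maximal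
proper `K`-congruence. -/
theorem exists_maximal_isKCong [L.IsAlgebraic] {K : StructClass L} (hK : IsQuasivariety K)
    {A : Type u} [iA : L.Structure A] (hA : K A iA) [Nontrivial A] (hc : TopKCompact K A) :
    ∃ θ : Setoid A, Maximal (fun θ => IsKCong K A θ ∧ θ ≠ ⊤) θ := by
  have hbot : IsKCong K A (⊥ : Setoid A) := by
    convert isKCong_ker hK hA (Hom.id L A)
    exact Setoid.ext fun a b => Iff.rfl
  have hbot' : (⊥ : Setoid A) ≠ ⊤ := fun h => by
    obtain ⟨a, b, hab⟩ := exists_pair_ne A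
    exact hab (Setoid.eq_top_iff.1 h a b)
  suffices hub : ∀ C ⊆ {θ : Setoid A | IsKCong K A θ ∧ θ ≠ ⊤}, IsChain (· ≤ ·) C →
      ∀ y ∈ C, ∃ σ ∈ {θ : Setoid A | IsKCong K A θ ∧ θ ≠ ⊤}, ∀ τ ∈ C, τ ≤ σ by
    obtain ⟨θ, -, hθ⟩ := zorn_le_nonempty₀ _ hub ⊥ ⟨hbot, hbot'⟩
    exact ⟨θ, hθ⟩
  intro C hC hchain y hy
  have : Nonempty C := ⟨⟨y, hy⟩⟩
  have : IsDirectedOrder C := hchain.directedOn.isDirectedOrder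
  obtain ⟨σ, hσ, hσ'⟩ := exists_isKCong_ultralimit hK
    (Ultrafilter.of (Filter.atTop : Filter C)) (fun θ => θ.1) fun θ => (hC θ.2).1
  have hub : ∀ τ ∈ C, τ ≤ σ := fun τ hτ a b hab =>
    (hσ' a b).2 (Ultrafilter.of_le _
      ((Filter.eventually_ge_atTop (⟨τ, hτ⟩ : C)).mono fun ρ (hρ : τ ≤ ρ.1) => hρ hab))
  have hlub : ∀ ρ : Setoid A, (∀ τ ∈ C, τ ≤ ρ) → σ ≤ ρ := fun ρ hρ a b hab => by
    obtain ⟨τ, hτ⟩ := ((hσ' a b).1 hab).exists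
    exact hρ τ.1 τ.2 hτ
  refine ⟨σ, ⟨hσ, ?_⟩, hub⟩
  rintro rfl
  obtain ⟨S₀, hS₀, hfin, htop⟩ := hc C (fun τ hτ => (hC hτ).1)
    fun ρ _ hρ => top_le_iff.1 (hlub ρ hρ)
  obtain ⟨τ, hτ, hle⟩ : ∃ τ ∈ C, ∀ ρ ∈ S₀, ρ ≤ τ := by
    obtain ⟨M, hM⟩ := (hfin.preimage Subtype.val_injective.injOn :
      ((↑) ⁻¹' S₀ : Set C).Finite).bddAbove
    exact ⟨M.1, M.2, fun ρ hρ => hM (show (⟨ρ, hS₀ hρ⟩ : C) ∈ _ from hρ)⟩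
  exact (hC hτ).2 (htop τ (hC hτ).1 hle)

theorem hasRelSimpleImage_of_topKCompact [L.IsAlgebraic] {K : StructClass L}
    (hK : IsQuasivariety K) {A : Type u} [iA : L.Structure A] (hA : K A iA) [Nontrivial A]
    (hc : TopKCompact K A) : HasRelSimpleImage K A := by
  obtain ⟨θ, ⟨⟨hcong, hQ⟩, hne⟩, hmax⟩ := exists_maximal_isKCong hK hA hc
  let := quotStructure L A θ hcong
  let q : A →[L] Quotient θ := quotHom A θ hcong
  have hq : Function.Surjective q := Quotient.mk_surjective
  refine ⟨Quotient θ, _, hQ, ⟨q, hq⟩, hQ, ?_, fun B iB hB hBnt h hsurj => ?_⟩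
  · by_contra hnt
    rw [not_nontrivial_iff_subsingleton] at hnt
    exact hne (Setoid.eq_top_iff.2 fun a b => Quotient.exact (Subsingleton.elim _ _))
  · have hker := isKCong_ker hK hB (h.comp q)
    have hker' : Setoid.ker (h.comp q) ≠ ⊤ := fun htop => by
      obtain ⟨b, c, hbc⟩ := exists_pair_ne B
      obtain ⟨a, rfl⟩ := (hsurj.comp hq) b
      obtain ⟨a', rfl⟩ := (hsurj.comp hq) c
      exact hbc (Setoid.eq_top_iff.1 htop a a')
    have hle := hmax ⟨hker, hker'⟩ fun a b hab => congrArg h (Quotient.sound hab)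
    intro x y hxy
    obtain ⟨a, rfl⟩ := hq x
    obtain ⟨b, rfl⟩ := hq y
    exact Quotient.sound (hle hxy)

/-- In a finitely generated algebra of finite type, the total relation is a finitely
generated congruence. -/
theorem exists_finite_forall_isCong_eq_top {A : Type u} [L.Structure A] [Nonempty A]
    (hfg : Structure.FG L A) [Finite (Σ n, L.Functions n)] :
    ∃ P : Set (A × A), P.Finite ∧
      ∀ θ : Setoid A, IsCong L A θ → (∀ p ∈ P, θ p.1 p.2) → θ = ⊤ := by
  obtain ⟨X, hX, hXtop⟩ := Substructure.fg_def.1 hfg.out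
  obtain ⟨a⟩ := ‹Nonempty A›
  refine ⟨(fun x => (a, x)) '' X ∪
    Set.range fun f : Σ n, L.Functions n => (a, funMap f.2 fun _ => a),
    (hX.image _).union (Set.finite_range _), fun θ hθ hP => ?_⟩
  have key : ∀ x, θ a x := by
    let N : L.Substructure A :=
      { carrier := {x | θ a x}
        fun_mem := fun {n} f x hx =>
          θ.trans (hP _ (Or.inr ⟨⟨n, f⟩, rfl⟩)) (hθ.1 n f _ _ hx) }
    have hN : Substructure.closure L X ≤ N :=
      Substructure.closure_le.2 fun x hx => hP _ (Or.inl ⟨x, hx, rfl⟩)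
    rw [hXtop] at hN
    exact fun x => hN (Substructure.mem_top x)
  exact Setoid.eq_top_iff.2 fun x y => θ.trans (θ.symm (key x)) (key y)

theorem topKCompact_of_fg [L.IsAlgebraic] {K : StructClass L} (hK : IsQuasivariety K)
    {A : Type u} [iA : L.Structure A] [Nonempty A] (hfg : Structure.FG L A)
    [Finite (Σ n, L.Functions n)] : TopKCompact K A := by
  classical
  obtain ⟨P, hPfin, hP⟩ := exists_finite_forall_isCong_eq_top hfg
  intro S hS htop
  by_contra! hcon
  have hcon' : ∀ F : Finset S, ∃ θ : Setoid A, IsKCong K A θ ∧ (∀ σ ∈ F, σ.1 ≤ θ) ∧ θ ≠ ⊤ := by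
    intro F
    obtain ⟨θ, hθ, hle, hne⟩ := hcon ((↑) '' (F : Set S)) (Subtype.coe_image_subset _ _)
      (F.finite_toSet.image _)
    exact ⟨θ, hθ, fun σ hσ => hle _ ⟨σ, hσ, rfl⟩, hne⟩
  choose θ hθ hle hne using hcon'
  obtain ⟨σ, hσ, hσ'⟩ := exists_isKCong_ultralimit hK
    (Ultrafilter.of (Filter.atTop : Filter (Finset S))) θ hθ
  obtain rfl : σ = ⊤ := htop σ hσ fun τ hτ a b hab =>
    (hσ' a b).2 (Ultrafilter.of_le _
      ((Filter.eventually_ge_atTop {(⟨τ, hτ⟩ : S)}).mono fun F hF =>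
        hle F ⟨τ, hτ⟩ (Finset.singleton_subset_iff.1 hF) hab))
  obtain ⟨F, hF⟩ := ((Filter.eventually_all_finite hPfin).2 fun p _ =>
    (hσ' p.1 p.2).1 trivial).exists
  exact hne F (hP _ (hθ F).choose hF)

/-- (i) if the total relation is compact in the lattice of
`K`-congruences of a nontrivial `A ∈ K`, then `A` has a `K`-simple homomorphic
image in `K`; (ii) if `A` is finitely generated of finite type, then the total
relation is compact and hence such an image exists. -/
theorem statement_4 (L : FirstOrder.Language.{u, u}) (halg : L.IsAlgebraic)
    (K : StructClass L) (hK : IsQuasivariety K)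
    (A : Type u) [iA : L.Structure A] (hA : K A iA) (hnt : Nontrivial A) :
    (TopKCompact K A → HasRelSimpleImage K A) ∧
    (Structure.FG L A → FiniteType L →
      TopKCompact K A ∧ HasRelSimpleImage K A) := by
  have hsimple : TopKCompact K A → HasRelSimpleImage K A :=
    hasRelSimpleImage_of_topKCompact hK hA
  refine ⟨hsimple, fun hfg hfin => ?_⟩
  have := hfin.1
  exact ⟨topKCompact_of_fg hK hfg, hsimple (topKCompact_of_fg hK hfg)⟩

end Paper
end

section
/- Let K be an algebraic quasivariety with the joint embedding property. If K has finite type or K is a Kollár quasivariety, then every nontrivial 0-generated member of K is relatively simple. -/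
universe u

open FirstOrder Language Structure

namespace Paper

variable {L : FirstOrder.Language.{u, u}}

/-- Homomorphisms out of a `0`-generated structure are unique. -/
theorem hom_ext_of_zeroGen {A B : Type u} [L.Structure A] [L.Structure B]
    (h0 : ZeroGen L A) (f g : A →[L] B) : f = g :=
  Hom.eq_of_eqOn_dense h0 (Set.eqOn_empty f g)

/-- in an algebraic quasivariety with the JEP which has finite
type or is a Kollár quasivariety, every nontrivial `0`-generated member is
relatively simple. -/
theorem statement_6 (L : FirstOrder.Language.{u, u}) (halg : L.IsAlgebraic)
    (K : StructClass L) (hK : IsQuasivariety K) (hjep : HasJEP K)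
    (h : FiniteType L ∨ IsKollar K)
    (A : Type u) [iA : L.Structure A] (hA : K A iA) (hnt : Nontrivial A)
    (h0 : ZeroGen L A) :
    RelSimple K A := by
  refine ⟨hA, hnt, fun B _ hB hBnt f _ => ?_⟩
  obtain ⟨C, _, -, ⟨eA⟩, ⟨eB⟩⟩ := hjep A B hA hB hnt hBnt
  have heq : eB.toHom.comp f = eA.toHom := hom_ext_of_zeroGen h0 _ _
  have hinj : Function.Injective (eB.toHom.comp f) := heq ▸ eA.injective
  exact Function.Injective.of_comp (f := eB) hinj

end Paper
end

section
/- Let K be a nontrivial Kollár quasivariety with the joint embedding property. Then there is a relatively simple algebra A ∈ K such that every relatively simple member of K belongs to I S P_u(A) (i.e., is isomorphic to a subalgebra of an ultrapower of A). Consequently Q(K_RS) = Q(A), where K_RS is the class of relatively simple members of K, and Q(K_RS) has the joint embedding property. -/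
universe u

open FirstOrder Language Structure

namespace Paper

variable {L : FirstOrder.Language.{u, u}}

section FlatEquations

/-- A flat equation `f (x₀, …, xₙ₋₁) = y` in variables indexed by `ℕ`. -/
abbrev FlatEquation (L : FirstOrder.Language.{u, u}) : Type u :=
  Σ n, L.Functions n × (Fin n → ℕ) × ℕ

/-- The finite system `F` of flat equations is solvable in `M`. -/
def Solvable (F : Finset (FlatEquation L)) (M : Type u) [L.Structure M] : Prop :=
  ∃ v : ℕ → M, ∀ p ∈ F, funMap p.2.1 (fun j => v (p.2.2.1 j)) = v p.2.2.2

/-- `D` solves every finite system of flat equations solvable in a nontrivial member of `K`. -/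
def SolvesAll (K : StructClass L) (D : Type u) [L.Structure D] : Prop :=
  ∀ F : Finset (FlatEquation L),
    (∃ (M : Type u) (_ : L.Structure M), K M ‹_› ∧ Nontrivial M ∧ Solvable F M) → Solvable F D

theorem Solvable.map {F : Finset (FlatEquation L)} {M N : Type u} [L.Structure M] [L.Structure N]
    (hF : Solvable F M) (h : M →[L] N) : Solvable F N := by
  obtain ⟨v, hv⟩ := hF
  exact ⟨fun n => h (v n), fun p hp =>
    (h.map_fun p.2.1 _).symm.trans (congrArg h (hv p hp))⟩

theorem SolvesAll.map {K : StructClass L} {M N : Type u} [L.Structure M] [L.Structure N]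
    (hM : SolvesAll K M) (h : M →[L] N) : SolvesAll K N :=
  fun F hF => (hM F hF).map h

end FlatEquations

section Homs

/-- A function preserving operations, viewed as a homomorphism of algebras. -/
def homOfMapFun [L.IsAlgebraic] {B N : Type u} [L.Structure B] [L.Structure N] (g : B → N)
    (hg : ∀ (n : ℕ) (f : L.Functions n) (x : Fin n → B),
      g (funMap f x) = funMap f fun j => g (x j)) : B →[L] N where
  toFun := g
  map_fun' f x := hg _ f x
  map_rel' r _ _ := isEmptyElim r

/-- The homomorphism into an ultraproduct induced by functions which, for each operation and each
tuple, eventually preserve the operation on that tuple. -/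
def homToProduct [L.IsAlgebraic] {ι : Type u} (uf : Ultrafilter ι) (M : ι → Type u) [∀ i, L.Structure (M i)]
    {B : Type u} [L.Structure B] (g : B → ∀ i, M i)
    (hg : ∀ (n : ℕ) (f : L.Functions n) (x : Fin n → B),
      ∀ᶠ i in (uf : Filter ι), g (funMap f x) i = funMap f fun j => g (x j) i) :
    B →[L] ((uf : Filter ι).Product M) :=
  homOfMapFun (fun b => ((g b : ∀ i, M i) : (uf : Filter ι).Product M)) fun _ f x =>
    Eq.trans (Quotient.sound' (hg _ f x)) (Ultraproduct.funMap_cast f fun j => g (x j)).symm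

theorem homToProduct_eq_iff [L.IsAlgebraic] {ι : Type u} (uf : Ultrafilter ι) (M : ι → Type u)
    [∀ i, L.Structure (M i)] {B : Type u} [L.Structure B] (g : B → ∀ i, M i)
    (hg : ∀ (n : ℕ) (f : L.Functions n) (x : Fin n → B),
      ∀ᶠ i in (uf : Filter ι), g (funMap f x) i = funMap f fun j => g (x j) i) (a b : B) :
    homToProduct uf M g hg a = homToProduct uf M g hg b ↔
      ∀ᶠ i in (uf : Filter ι), g a i = g b i :=
  Quotient.eq''

/-- The homomorphism of ultraproducts induced by functions which are eventually homomorphisms. -/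
def productMap [L.IsAlgebraic] {ι : Type u} (uf : Ultrafilter ι) (M N : ι → Type u)
    [∀ i, L.Structure (M i)] [∀ i, L.Structure (N i)] (g : ∀ i, M i → N i)
    (hg : ∀ᶠ i in (uf : Filter ι), ∀ (n : ℕ) (f : L.Functions n) (x : Fin n → M i),
      g i (funMap f x) = funMap f fun j => g i (x j)) :
    ((uf : Filter ι).Product M) →[L] ((uf : Filter ι).Product N) :=
  homOfMapFun
    (Quotient.map' (fun x i => g i (x i)) fun _ _ hxy => Filter.Eventually.mono hxy fun i hi =>
      congrArg (g i) hi)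
    fun n f x => by
      obtain ⟨y, rfl⟩ : ∃ y : Fin n → ∀ i, M i,
          (fun j => ((y j : ∀ i, M i) : (uf : Filter ι).Product M)) = x :=
        ⟨fun j => (x j).out, funext fun j => Quotient.out_eq' _⟩
      refine (congrArg _ (Ultraproduct.funMap_cast f y)).trans
        (Eq.trans ?_ (Ultraproduct.funMap_cast f fun j i => g i (y j i)).symm)
      refine Quotient.sound' ?_
      filter_upwards [hg] with i hi using hi n f _

/-- The diagonal homomorphism into an ultrapower. -/
def diagonal [L.IsAlgebraic] {ι : Type u} (uf : Ultrafilter ι) (M : Type u) [L.Structure M] :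
    M →[L] ((uf : Filter ι).Product fun _ : ι => M) :=
  homToProduct uf (fun _ => M) (fun b _ => b) fun _ _ _ => Filter.Eventually.of_forall fun _ => rfl

theorem diagonal_injective [L.IsAlgebraic] {ι : Type u} (uf : Ultrafilter ι) (M : Type u) [L.Structure M] :
    Function.Injective (diagonal (L := L) uf M) := fun a b hab => by
  obtain ⟨_, hi⟩ := ((homToProduct_eq_iff uf (fun _ => M) _ _ a b).1 hab).exists
  exact hi

theorem Solvable.product {F : Finset (FlatEquation L)} {ι : Type u} (uf : Ultrafilter ι)
    (M : ι → Type u) [∀ i, L.Structure (M i)] [∀ i, Nonempty (M i)]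
    (h : ∀ᶠ i in (uf : Filter ι), Solvable F (M i)) : Solvable F ((uf : Filter ι).Product M) := by
  classical
  have key : ∀ i, ∃ v : ℕ → M i, Solvable F (M i) →
      ∀ p ∈ F, funMap p.2.1 (fun j => v (p.2.2.1 j)) = v p.2.2.2 := by
    intro i
    by_cases hi : Solvable F (M i)
    · obtain ⟨v, hv⟩ := hi
      exact ⟨v, fun _ => hv⟩
    · exact ⟨fun _ => Classical.arbitrary _, fun h => absurd h hi⟩
  choose v hv using key
  refine ⟨fun n => ((fun i => v i n : ∀ i, M i) : (uf : Filter ι).Product M), fun p hp => ?_⟩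
  refine (Ultraproduct.funMap_cast p.2.1 fun j i => v i (p.2.2.1 j)).trans (Quotient.sound' ?_)
  filter_upwards [h] with i hi using hv i hi p hp

theorem SolvesAll.nonempty {K : StructClass L} (hnt : NontrivialClass K) {D : Type u}
    [L.Structure D] (hD : SolvesAll K D) : Nonempty D := by
  obtain ⟨M, iM, hM, hM'⟩ := hnt
  obtain ⟨v, -⟩ := hD ∅ ⟨M, iM, hM, hM', ⟨fun _ => Classical.arbitrary M, by simp⟩⟩
  exact ⟨v 0⟩

theorem SolvesAll.product {K : StructClass L} (hnt : NontrivialClass K) {ι : Type u}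
    (uf : Ultrafilter ι) (M : ι → Type u) [∀ i, L.Structure (M i)]
    (h : ∀ i, SolvesAll K (M i)) : SolvesAll K ((uf : Filter ι).Product M) := by
  have := fun i => (h i).nonempty hnt
  exact fun F hF => Solvable.product uf M (Filter.Eventually.of_forall fun i => h i F hF)

theorem product_nontrivial {ι : Type u} (uf : Ultrafilter ι) (M : ι → Type u)
    [∀ i, Nontrivial (M i)] : Nontrivial ((uf : Filter ι).Product M) := by
  choose a b hab using fun i => exists_pair_ne (M i)
  refine ⟨(a : (uf : Filter ι).Product M), (b : (uf : Filter ι).Product M), fun h => ?_⟩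
  obtain ⟨i, hi⟩ := Filter.Eventually.exists (f := (uf : Filter ι)) (Quotient.exact' h)
  exact hab i hi

/-- Any finite part of the diagram of a nontrivial member of `K` can be realized in `D`. -/
theorem SolvesAll.exists_partial_hom {K : StructClass L} {D : Type u} [L.Structure D]
    (hD : SolvesAll K D) {B : Type u} [L.Structure B] (hB : K B ‹_›) [Nontrivial B]
    (G : Finset (Σ n, L.Functions n × (Fin n → B))) :
    ∃ g : B → D, ∀ p ∈ G, g (funMap p.2.1 p.2.2) = funMap p.2.1 fun j => g (p.2.2 j) := by
  classical
  let T : Set B := insert (Classical.arbitrary B)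
    (⋃ p ∈ G, insert (funMap p.2.1 p.2.2) (Set.range p.2.2))
  have hT : T.Countable := by
    refine Set.Countable.insert _ (Set.Countable.biUnion G.countable_toSet fun p _ => ?_)
    exact (Set.countable_range _).insert _
  obtain ⟨v, hv⟩ := hT.exists_eq_range (Set.insert_nonempty _ _)
  have hinv : ∀ b ∈ T, v (Function.invFun v b) = b := fun b hb =>
    Function.invFun_eq (by rw [hv] at hb; exact hb)
  have hmem : ∀ p ∈ G, ∀ b ∈ insert (funMap p.2.1 p.2.2) (Set.range p.2.2), b ∈ T :=
    fun p hp b hb => Set.mem_insert_of_mem _ (Set.mem_biUnion hp hb)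
  let enc (p : Σ n, L.Functions n × (Fin n → B)) : FlatEquation L :=
    ⟨p.1, p.2.1, fun j => Function.invFun v (p.2.2 j), Function.invFun v (funMap p.2.1 p.2.2)⟩
  obtain ⟨w, hw⟩ := hD (G.image enc) ⟨B, ‹_›, hB, ‹_›, v, by
      intro q hq
      obtain ⟨p, hp, rfl⟩ := Finset.mem_image.1 hq
      have h1 := hinv _ (hmem p hp _ (Set.mem_insert _ _))
      have h2 := fun j => hinv _ (hmem p hp _ (Set.mem_insert_of_mem _ (Set.mem_range_self j)))
      simp only [enc, h1, h2]⟩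
  exact ⟨fun b => w (Function.invFun v b), fun p hp => (hw _ (Finset.mem_image_of_mem enc hp)).symm⟩

theorem SolvesAll.mapsIntoUltrapower [L.IsAlgebraic] {K : StructClass L} {D : Type u} [L.Structure D]
    (hD : SolvesAll K D) {B : Type u} [L.Structure B] (hB : K B ‹_›) [Nontrivial B] :
    MapsIntoUltrapower L B D := by
  choose g hg using fun G => hD.exists_partial_hom hB G
  let uf : Ultrafilter (Finset (Σ n, L.Functions n × (Fin n → B))) := Ultrafilter.of Filter.atTop
  refine ⟨_, uf, ⟨homToProduct uf (fun _ => D) (fun b G => g G b) fun n f x => ?_⟩⟩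
  have : ∀ᶠ G in (uf : Filter (Finset (Σ n, L.Functions n × (Fin n → B)))),
      {⟨n, f, x⟩} ≤ G :=
    Ultrafilter.of_le Filter.atTop (Filter.eventually_ge_atTop _)
  filter_upwards [this] with G hG using hg G ⟨n, f, x⟩ (hG (Finset.mem_singleton_self _))

end Homs

section Quasivarieties

variable {K : StructClass L}

theorem isQuasivariety_qGen (C : StructClass L) : IsQuasivariety (QGen C) where
  iso_closed M _ N _ h hM K' hK' hC := hK'.iso_closed M N h (hM K' hK' hC)
  sub_closed M _ N _ h hN K' hK' hC := hK'.sub_closed M N h (hN K' hK' hC)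
  prod_closed ι M _ h K' hK' hC := hK'.prod_closed ι M fun i => h i K' hK' hC
  ultra_closed ι M _ uf h K' hK' hC := hK'.ultra_closed ι M uf fun i => h i K' hK' hC

theorem subClass_qGen (C : StructClass L) : SubClass C (QGen C) :=
  fun M iM hM _ _ hC => hC M iM hM

theorem IsKollar.range_nontrivial (hkol : IsKollar K) {B N : Type u} [L.Structure B]
    [L.Structure N] [Nonempty B] (hN : K N ‹_›) [Nontrivial N] (h : B →[L] N) :
    Nontrivial h.range := by
  by_contra hcon
  rw [not_nontrivial_iff_subsingleton] at hcon
  obtain ⟨b⟩ := ‹Nonempty B›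
  have hb : ∀ x, h x = h b := fun x =>
    congrArg Subtype.val
      (Subsingleton.elim (⟨h x, h.mem_range_self x⟩ : h.range) ⟨h b, h.mem_range_self b⟩)
  exact hkol N hN ‹_› ⟨h b, fun n f => (h.map_fun f fun _ => b).symm.trans (hb _)⟩

theorem IsQuasivariety.range_mem (hK : IsQuasivariety K) {B N : Type u} [L.Structure B]
    [L.Structure N] (hN : K N ‹_›) (h : B →[L] N) : K h.range inferInstance :=
  hK.sub_closed _ N ⟨h.range.subtype⟩ hN

/-- The homomorphism onto the range. -/
def rangeRestrict {B N : Type u} [L.Structure B] [L.Structure N] (h : B →[L] N) :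
    B →[L] h.range :=
  h.codRestrict h.range h.mem_range_self

theorem rangeRestrict_surjective {B N : Type u} [L.Structure B] [L.Structure N] (h : B →[L] N) :
    Function.Surjective (rangeRestrict h) := by
  rintro ⟨y, hy⟩
  obtain ⟨x, rfl⟩ := Hom.mem_range.1 hy
  exact ⟨x, rfl⟩

theorem RelSimple.injective (hK : IsQuasivariety K) (hkol : IsKollar K) {B N : Type u}
    [L.Structure B] [L.Structure N] (hB : RelSimple K B) (hN : K N ‹_›) [Nontrivial N]
    (h : B →[L] N) : Function.Injective h := by
  have := hB.2.1
  have hinj := hB.2.2 h.range (hK.range_mem hN h) (hkol.range_nontrivial hN h) (rangeRestrict h)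
    (rangeRestrict_surjective h)
  exact fun a b hab => hinj (Subtype.ext hab)

theorem exists_hom_relSimple [L.IsAlgebraic] (hK : IsQuasivariety K) (hkol : IsKollar K) (C : Type u)
    [L.Structure C] (hC : K C ‹_›) [Nontrivial C] :
    ∃ (A : Type u) (_ : L.Structure A), RelSimple K A ∧ Nonempty (C →[L] A) := by
  let P : Set (Setoid C) := {θ | ∃ (N : Type u) (_ : L.Structure N) (h : C →[L] N),
    K N ‹_› ∧ Nontrivial N ∧ ∀ a b, θ a b ↔ h a = h b}
  obtain ⟨θ, -, hθ⟩ := zorn_le_nonempty₀ P (fun c hcP hc y hy => by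
    choose N iN h hN hN' hker using fun i : c => hcP i.2
    have : Nonempty c := ⟨⟨y, hy⟩⟩
    have : IsDirectedOrder c := ⟨fun i j => by
      rcases hc.total i.2 j.2 with hij | hij
      · exact ⟨j, hij, le_rfl⟩
      · exact ⟨i, le_rfl, hij⟩⟩
    let uf : Ultrafilter c := Ultrafilter.of Filter.atTop
    let H := homToProduct uf N (fun a i => h i a) fun n f x =>
      Filter.Eventually.of_forall fun i => (h i).map_fun f x
    refine ⟨Setoid.ker H, ⟨_, _, H, hK.ultra_closed _ N uf hN, product_nontrivial uf N,
      fun a b => Iff.rfl⟩, fun z hz a b hab => ?_⟩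
    refine (homToProduct_eq_iff uf N _ _ a b).2 ?_
    have : ∀ᶠ i in (uf : Filter c), ⟨z, hz⟩ ≤ i :=
      Ultrafilter.of_le Filter.atTop (Filter.eventually_ge_atTop _)
    filter_upwards [this] with i hi using (hker i a b).1 (hi hab)) ⊥
    ⟨C, _, Hom.id L C, hC, ‹_›, fun a b => Iff.rfl⟩
  obtain ⟨N, iN, h, hN, hN', hker⟩ := hθ.prop
  refine ⟨h.range, inferInstance, ⟨hK.range_mem hN h, hkol.range_nontrivial hN h, ?_⟩,
    ⟨rangeRestrict h⟩⟩
  intro B iB hB hB' g _ x y hxy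
  obtain ⟨a, rfl⟩ := rangeRestrict_surjective h x
  obtain ⟨b, rfl⟩ := rangeRestrict_surjective h y
  have hle : θ ≤ Setoid.ker (g.comp (rangeRestrict h)) := fun a b hab => by
    have : rangeRestrict h a = rangeRestrict h b := Subtype.ext ((hker a b).1 hab)
    exact congrArg g this
  have hge := hθ.le_of_ge (y := Setoid.ker (g.comp (rangeRestrict h)))
    ⟨B, iB, g.comp (rangeRestrict h), hB, hB', fun a b => Iff.rfl⟩ hle
  exact Subtype.ext ((hker a b).1 (hge hxy))

theorem exists_solvesAll (hK : IsQuasivariety K) (hnt : NontrivialClass K) (hjep : HasJEP K) :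
    ∃ (C : Type u) (_ : L.Structure C), K C ‹_› ∧ Nontrivial C ∧ SolvesAll K C := by
  classical
  let I := {F : Finset (FlatEquation L) //
    ∃ (M : Type u) (_ : L.Structure M), K M ‹_› ∧ Nontrivial M ∧ Solvable F M}
  have key : ∀ s : Finset I, ∃ (M : Type u) (_ : L.Structure M), K M ‹_› ∧ Nontrivial M ∧
      ∀ F ∈ s, Solvable F.1 M := by
    intro s
    induction s using Finset.induction_on with
    | empty =>
      obtain ⟨M, iM, hM, hM'⟩ := hnt
      exact ⟨M, iM, hM, hM', by simp⟩
    | insert F s _ ih =>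
      obtain ⟨M, iM, hM, hM', hs⟩ := ih
      obtain ⟨N, iN, hN, hN', hF⟩ := F.2
      obtain ⟨C, iC, hC, ⟨e₁⟩, ⟨e₂⟩⟩ := hjep M N hM hN hM' hN'
      refine ⟨C, iC, hC, e₁.injective.nontrivial, fun G hG => ?_⟩
      rcases Finset.mem_insert.1 hG with rfl | hG
      · exact hF.map e₂.toHom
      · exact (hs G hG).map e₁.toHom
  choose M iM hM hM' hs using key
  let uf : Ultrafilter (Finset I) := Ultrafilter.of Filter.atTop
  refine ⟨_, _, hK.ultra_closed _ M uf hM, product_nontrivial uf M, fun F hF => ?_⟩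
  refine Solvable.product uf M ?_
  have : ∀ᶠ s in (uf : Filter (Finset I)), {(⟨F, hF⟩ : I)} ≤ s :=
    Ultrafilter.of_le Filter.atTop (Filter.eventually_ge_atTop _)
  filter_upwards [this] with s hs' using hs s ⟨F, hF⟩ (hs' (Finset.mem_singleton_self _))

theorem RelSimple.of_equiv (hK : IsQuasivariety K) {A M : Type u} [L.Structure A] [L.Structure M]
    (hA : RelSimple K A) (e : M ≃[L] A) : RelSimple K M := by
  have := hA.2.1
  refine ⟨hK.sub_closed M A ⟨e.toEmbedding⟩ hA.1, e.symm.injective.nontrivial,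
    fun B _ hB hB' h hh => ?_⟩
  have hinj := hA.2.2 B hB hB' (h.comp e.symm.toHom) (hh.comp e.symm.surjective)
  intro x y hxy
  refine e.injective (hinj ?_)
  change h (e.symm (e x)) = h (e.symm (e y))
  simpa using hxy

/-- The structures whose points are separated by homomorphisms into members of `Q` that solve all
finite systems solvable in nontrivial members of `K`. -/
def SeparatedClass (K Q : StructClass L) : StructClass L := fun M _ =>
  ∀ a b : M, a ≠ b → ∃ (D : Type u) (_ : L.Structure D), Q D ‹_› ∧ SolvesAll K D ∧
    ∃ h : M →[L] D, h a ≠ h b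

theorem isQuasivariety_separatedClass [L.IsAlgebraic] (hnt : NontrivialClass K) {Q : StructClass L}
    (hQ : IsQuasivariety Q) {A : Type u} [L.Structure A] (hA : Q A ‹_›) (hA' : SolvesAll K A) :
    IsQuasivariety (SeparatedClass K Q) := by
  have sub : ∀ (M : Type u) [iM : L.Structure M] (N : Type u) [iN : L.Structure N],
      Nonempty (M ↪[L] N) → SeparatedClass K Q N iN → SeparatedClass K Q M iM := by
    rintro M _ N _ ⟨e⟩ hN a b hab
    obtain ⟨D, iD, hD, hD', h, hh⟩ := hN (e a) (e b) (e.injective.ne hab)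
    exact ⟨D, iD, hD, hD', h.comp e.toHom, hh⟩
  refine ⟨fun M _ N _ ⟨e⟩ hM => sub N M ⟨e.symm.toEmbedding⟩ hM, sub, ?_, ?_⟩
  · intro ι M _ hM a b hab
    obtain ⟨i, hi⟩ := Function.ne_iff.1 hab
    obtain ⟨D, iD, hD, hD', h, hh⟩ := hM i (a i) (b i) hi
    let := piStructure (L := L) M
    exact ⟨D, iD, hD, hD', homOfMapFun (fun x => h (x i)) fun n f x => h.map_fun f _, hh⟩
  · intro ι M _ uf hM a b hab
    induction a using Quotient.inductionOn' with | _ a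
    induction b using Quotient.inductionOn' with | _ b
    have : ∀ i, ∃ (D : Type u) (_ : L.Structure D), Q D ‹_› ∧ SolvesAll K D ∧
        ∃ h : M i → D, a i ≠ b i → h (a i) ≠ h (b i) ∧
          ∀ (n : ℕ) (f : L.Functions n) (x : Fin n → M i),
            h (funMap f x) = funMap f fun j => h (x j) := by
      intro i
      by_cases hi : a i = b i
      · obtain ⟨c⟩ := hA'.nonempty hnt
        exact ⟨A, _, hA, hA', fun _ => c, fun h => absurd hi h⟩
      · obtain ⟨D, iD, hD, hD', h, hh⟩ := hM i _ _ hi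
        exact ⟨D, iD, hD, hD', h, fun _ => ⟨hh, fun n f x => h.map_fun f x⟩⟩
    choose D iD hD hD' h hh using this
    have hne : ∀ᶠ i in (uf : Filter ι), a i ≠ b i :=
      Ultrafilter.eventually_not.2 fun hab' => hab (Quotient.sound' hab')
    refine ⟨_, _, hQ.ultra_closed ι D uf hD, SolvesAll.product hnt uf D hD',
      productMap uf M D h ?_, fun heq => ?_⟩
    · filter_upwards [hne] with i hi using (hh i hi).2
    · have heq' : ∀ᶠ i in (uf : Filter ι), h i (a i) = h i (b i) := Quotient.exact' heq
      obtain ⟨i, hi, hi'⟩ := (hne.and heq').exists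
      exact (hh i hi).1 hi'

theorem SeparatedClass.exists_common_target [L.IsAlgebraic] {Q : StructClass L} (hQ : IsQuasivariety Q)
    {M N : Type u} [L.Structure M] [L.Structure N] (hM : SeparatedClass K Q M ‹_›)
    (hN : K N ‹_›) [Nontrivial N] (a b : M) (hab : a ≠ b) :
    ∃ (E : Type u) (_ : L.Structure E) (h : M →[L] E) (_ : N →[L] E), Q E ‹_› ∧ h a ≠ h b := by
  obtain ⟨D, iD, hD, hD', h, hh⟩ := hM a b hab
  obtain ⟨ι, uf, ⟨k⟩⟩ := hD'.mapsIntoUltrapower hN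
  exact ⟨_, _, (diagonal uf D).comp h, k, hQ.ultra_closed ι (fun _ => D) uf fun _ => hD,
    (diagonal_injective (L := L) uf D).ne hh⟩

theorem hasJEP_of_subClass_separatedClass [L.IsAlgebraic] {Q : StructClass L} (hQ : IsQuasivariety Q)
    (hQK : SubClass Q K) (hsep : SubClass Q (SeparatedClass K Q)) : HasJEP Q := by
  intro M iM N iN hM hN hM' hN'
  have key : ∀ j : {p : M × M // p.1 ≠ p.2} ⊕ {p : N × N // p.1 ≠ p.2},
      ∃ (E : Type u) (_ : L.Structure E) (h : M →[L] E) (k : N →[L] E), Q E ‹_› ∧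
        (∀ p, j = Sum.inl p → h p.1.1 ≠ h p.1.2) ∧ ∀ p, j = Sum.inr p → k p.1.1 ≠ k p.1.2 := by
    rintro (p | p)
    · obtain ⟨E, iE, h, k, hE, hne⟩ :=
        (hsep M iM hM).exists_common_target hQ (hQK N iN hN) p.1.1 p.1.2 p.2
      exact ⟨E, iE, h, k, hE, fun q hq => by obtain rfl := Sum.inl.inj hq; exact hne, nofun⟩
    · obtain ⟨E, iE, k, h, hE, hne⟩ :=
        (hsep N iN hN).exists_common_target hQ (hQK M iM hM) p.1.1 p.1.2 p.2
      exact ⟨E, iE, h, k, hE, nofun, fun q hq => by obtain rfl := Sum.inr.inj hq; exact hne⟩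
  choose E iE h k hE hl hr using key
  refine ⟨_, _, hQ.prod_closed _ E hE, ?_, ?_⟩ <;> let := piStructure (L := L) E
  · let H : M →[L] ∀ j, E j :=
      homOfMapFun (fun a j => h j a) fun n f x => funext fun j => (h j).map_fun f x
    refine ⟨Embedding.ofInjective (f := H) fun a b hab => ?_⟩
    by_contra hne
    exact hl _ ⟨(a, b), hne⟩ rfl (congrFun hab _)
  · let H : N →[L] ∀ j, E j :=
      homOfMapFun (fun a j => k j a) fun n f x => funext fun j => (k j).map_fun f x
    refine ⟨Embedding.ofInjective (f := H) fun a b hab => ?_⟩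
    by_contra hne
    exact hr _ ⟨(a, b), hne⟩ rfl (congrFun hab _)

end Quasivarieties

/-- a nontrivial Kollár quasivariety with the JEP has a relatively
simple member `A` such that every relatively simple member embeds into an
ultrapower of `A`; consequently `Q(K_RS) = Q(A)` and `Q(K_RS)` has the JEP. -/
theorem statement_7 (L : FirstOrder.Language.{u, u}) (halg : L.IsAlgebraic)
    (K : StructClass L) (hK : IsQuasivariety K) (hkol : IsKollar K)
    (hnt : NontrivialClass K) (hjep : HasJEP K) :
    ∃ (A : Type u) (iA : L.Structure A), @RelSimple L K A iA ∧
      (∀ (B : Type u) (iB : L.Structure B), @RelSimple L K B iB →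
        @EmbedsIntoUltrapower L B A iB iA) ∧
      EqClass (QGen (RelSimpleClass K)) (QGen (@ClassOf L A iA)) ∧
      HasJEP (QGen (RelSimpleClass K)) := by
  obtain ⟨C, iC, hC, hC', hCs⟩ := exists_solvesAll hK hnt hjep
  obtain ⟨A, iA, hA, ⟨q⟩⟩ := exists_hom_relSimple hK hkol C hC
  have hAs : SolvesAll K A := hCs.map q
  have hAnt := hA.2.1
  have hemb : ∀ (B : Type u) (iB : L.Structure B), RelSimple K B → EmbedsIntoUltrapower L B A := by
    intro B iB hB
    have hBnt := hB.2.1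
    obtain ⟨ι, uf, ⟨h⟩⟩ := hAs.mapsIntoUltrapower hB.1
    have := product_nontrivial uf fun _ => A
    exact ⟨ι, uf, ⟨Embedding.ofInjective
      (hB.injective hK hkol (hK.ultra_closed ι (fun _ => A) uf fun _ => hA.1) h)⟩⟩
  have hQ := isQuasivariety_qGen (RelSimpleClass K)
  have hAQ := subClass_qGen (RelSimpleClass K) A iA hA
  refine ⟨A, iA, hA, hemb, fun M iM => ⟨fun hM Q hQ' hAQ' => ?_, fun hM Q hQ' hRS => ?_⟩,
    hasJEP_of_subClass_separatedClass hQ (fun M iM hM => hM K hK fun _ _ h => h.1)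
      fun M iM hM => hM _ (isQuasivariety_separatedClass hnt hQ hAQ hAs) ?_⟩
  · refine hM Q hQ' fun B iB hB => ?_
    obtain ⟨ι, uf, he⟩ := hemb B iB hB
    exact hQ'.sub_closed _ _ he
      (hQ'.ultra_closed ι (fun _ => A) uf fun _ => hAQ' A iA ⟨Language.Equiv.refl L A⟩)
  · exact hM Q hQ' fun B iB ⟨e⟩ => hRS B iB (RelSimple.of_equiv hK hA e)
  · intro B iB hB a b hab
    obtain ⟨ι, uf, ⟨e⟩⟩ := hemb B iB hB
    exact ⟨_, _, hQ.ultra_closed ι (fun _ => A) uf fun _ => hAQ,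
      hAs.map (diagonal uf A), e.toHom, e.injective.ne hab⟩

end Paper
end

section
/- Let K be a nontrivial, relatively semisimple Kollár quasivariety with the joint embedding property. Then K = Q(A) for some relatively simple algebra A ∈ K. -/
universe u

open FirstOrder Language Structure

namespace Paper

variable {L : FirstOrder.Language.{u, u}}

/-- A map into a product that preserves each operation on almost all coordinates, with respect to
an ultrafilter, induces a homomorphism into the ultraproduct. -/
def homToUltraproduct [L.IsAlgebraic] {ι : Type u} (uf : Ultrafilter ι) {M : Type u}
    [L.Structure M] (N : ι → Type u) [∀ i, L.Structure (N i)] (f : M → ∀ i, N i)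
    (hf : ∀ {n : ℕ} (g : L.Functions n) (x : Fin n → M),
      ∀ᶠ i in (uf : Filter ι), f (funMap g x) i = funMap g fun j => f (x j) i) :
    M →[L] (uf : Filter ι).Product N where
  toFun a := (f a : (uf : Filter ι).Product N)
  map_fun' g x := (Quotient.sound (hf g x)).trans
    (Ultraproduct.funMap_cast g fun j => f (x j)).symm
  map_rel' r := isEmptyElim r

theorem homToUltraproduct_eq_iff [L.IsAlgebraic] {ι : Type u} (uf : Ultrafilter ι) {M : Type u}
    [L.Structure M] (N : ι → Type u) [∀ i, L.Structure (N i)] (f : M → ∀ i, N i)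
    (hf : ∀ {n : ℕ} (g : L.Functions n) (x : Fin n → M),
      ∀ᶠ i in (uf : Filter ι), f (funMap g x) i = funMap g fun j => f (x j) i) (a b : M) :
    homToUltraproduct uf N f hf a = homToUltraproduct uf N f hf b ↔
      ∀ᶠ i in (uf : Filter ι), f a i = f b i :=
  ⟨fun h => Quotient.exact h, fun h => Quotient.sound h⟩

/-- On a directed index type, some ultrafilter contains all the tails. -/
theorem exists_ultrafilter_le_atTop (ι : Type u) [Preorder ι] [IsDirectedOrder ι] [Nonempty ι] :
    ∃ uf : Ultrafilter ι, ∀ i, ∀ᶠ j in (uf : Filter ι), i ≤ j :=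
  ⟨Ultrafilter.of Filter.atTop, fun i => Ultrafilter.of_le _ (Filter.eventually_ge_atTop i)⟩

/-- A structure whose points are separated by homomorphisms into members of a quasivariety
belongs to the quasivariety. -/
theorem IsQuasivariety.mem_of_separated [L.IsAlgebraic] {K : StructClass L}
    (hK : IsQuasivariety K) (M : Type u) [iM : L.Structure M]
    (h : ∀ a b : M, a ≠ b → ∃ (N : Type u) (iN : L.Structure N), K N iN ∧
      ∃ f : M →[L] N, f a ≠ f b) : K M iM := by
  choose N iN hN f hf using fun p : {p : M × M // p.1 ≠ p.2} => h p.1.1 p.1.2 p.2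
  let _ := piStructure (L := L) N
  let F : M →[L] (∀ p, N p) :=
    { toFun := fun a p => f p a
      map_fun' := fun g x => funext fun p => (f p).map_fun g x
      map_rel' := fun r => isEmptyElim r }
  have hF : Function.Injective F := fun a b hab => by
    by_contra hne
    exact hf ⟨(a, b), hne⟩ (congrFun hab ⟨(a, b), hne⟩)
  exact hK.sub_closed M (∀ p, N p) ⟨Embedding.ofInjective hF⟩ (hK.prod_closed _ N hN)

/-- Distinct points of a member of a quasivariety are separated by a homomorphism onto a
relatively subdirectly irreducible member. -/
theorem IsQuasivariety.exists_relSDI_separating [L.IsAlgebraic] {K : StructClass L}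
    (hK : IsQuasivariety K) (C : Type u) [iC : L.Structure C] (hC : K C iC) {a b : C}
    (hab : a ≠ b) :
    ∃ (S : Type u) (_ : L.Structure S), RelSDI K S ∧
      ∃ h : C →[L] S, Function.Surjective h ∧ h a ≠ h b := by
  let T : Set (Setoid C) := {θ | ¬ θ a b ∧ ∃ (N : Type u) (iN : L.Structure N), K N iN ∧
    ∃ h : C →[L] N, ∀ x y, θ x y ↔ h x = h y}
  obtain ⟨θ, -, hθ⟩ := zorn_le_nonempty₀ T (fun c hcT hc θ₀ hθ₀ => by
      choose N iN hN h hh using fun σ : c => (hcT σ.2).2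
      have : Nonempty c := ⟨⟨θ₀, hθ₀⟩⟩
      have : IsDirectedOrder c := ⟨fun σ τ => by
        rcases hc.total σ.2 τ.2 with hle | hle
        · exact ⟨τ, hle, le_rfl⟩
        · exact ⟨σ, le_rfl, hle⟩⟩
      obtain ⟨uf, huf⟩ := exists_ultrafilter_le_atTop c
      have hf : ∀ {n : ℕ} (g : L.Functions n) (x : Fin n → C),
          ∀ᶠ i in (uf : Filter c), h i (funMap g x) = funMap g fun j => h i (x j) :=
        fun g x => Filter.Eventually.of_forall fun i => (h i).map_fun g x
      let H := homToUltraproduct uf N (fun x σ => h σ x) hf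
      have hH : ∀ x y, H x = H y ↔ ∀ᶠ σ in (uf : Filter c), h σ x = h σ y :=
        homToUltraproduct_eq_iff uf N (fun x σ => h σ x) hf
      refine ⟨Setoid.ker H, ⟨fun hker => ?_, _, _, hK.ultra_closed c N uf hN, H,
        fun x y => Iff.rfl⟩, fun σ hσ x y hxy => ?_⟩
      · obtain ⟨σ, hσ⟩ := ((hH a b).1 hker).exists
        exact (hcT σ.2).1 ((hh σ a b).2 hσ)
      · exact (hH x y).2 ((huf ⟨σ, hσ⟩).mono fun τ hτ => (hh τ x y).1 (hτ hxy)))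
    ⊥ ⟨hab, C, iC, hC, Hom.id L C, fun x y => Iff.rfl⟩
  obtain ⟨⟨hθab, N, iN, hN, h, hh⟩, hmax⟩ := hθ
  let π : C →[L] h.range := h.codRestrict h.range h.mem_range_self
  have hπ : ∀ x y, π x = π y ↔ θ x y := fun x y => by
    rw [hh]; exact Subtype.ext_iff
  have hsurj : Function.Surjective π := by
    rintro ⟨_, x, rfl⟩
    exact ⟨x, rfl⟩
  refine ⟨h.range, inferInstance, ⟨hK.sub_closed _ N ⟨h.range.subtype⟩ hN, ?_⟩, π, hsurj,
    fun he => hθab ((hπ a b).1 he)⟩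
  intro ι M iM hM e he
  let _ := piStructure (L := L) M
  have hne : e (π a) ≠ e (π b) := fun hab => hθab ((hπ a b).1 (e.injective hab))
  obtain ⟨i, hi⟩ := Function.ne_iff.1 hne
  let k : C →[L] M i :=
    { toFun := fun x => e (π x) i
      map_fun' := fun g x => by
        rw [π.map_fun, e.map_fun]; rfl
      map_rel' := fun r => isEmptyElim r }
  have hle : Setoid.ker k ≤ θ := hmax ⟨hi, M i, iM i, hM i, k, fun x y => Iff.rfl⟩
    fun x y hxy => congrArg (fun z => e z i) ((hπ x y).2 hxy)
  refine ⟨i, fun x y hxy => ?_, he i⟩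
  obtain ⟨x, rfl⟩ := hsurj x
  obtain ⟨y, rfl⟩ := hsurj y
  exact (hπ x y).2 (hle hxy)

/-- Under the JEP, any finite family of nontrivial members of a class embeds into a common
nontrivial member. -/
theorem HasJEP.exists_finset_target {K : StructClass L} (hjep : HasJEP K)
    (hnt : NontrivialClass K) {I : Type u} (S : I → Type u) [iS : ∀ i, L.Structure (S i)]
    (hS : ∀ i, K (S i) (iS i)) (hSn : ∀ i, Nontrivial (S i)) (F : Finset I) :
    ∃ (B : Type u) (iB : L.Structure B), K B iB ∧ Nontrivial B ∧
      ∀ i ∈ F, Nonempty (S i ↪[L] B) := by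
  classical
  induction F using Finset.induction_on with
  | empty =>
    obtain ⟨B, iB, hB, hBn⟩ := hnt
    exact ⟨B, iB, hB, hBn, by simp⟩
  | insert i F _ ih =>
    obtain ⟨B, iB, hB, hBn, hF⟩ := ih
    obtain ⟨D, iD, hD, ⟨e⟩, ⟨e'⟩⟩ := hjep B (S i) hB (hS i) hBn (hSn i)
    refine ⟨D, iD, hD, e.injective.nontrivial, fun j hj => ?_⟩
    rcases Finset.mem_insert.1 hj with rfl | hj
    · exact ⟨e'⟩
    · exact (hF j hj).map fun f => e.comp f

/-- In a quasivariety with the JEP, any small family of nontrivial members maps into a common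
nontrivial member. -/
theorem IsQuasivariety.exists_common_target [L.IsAlgebraic] {K : StructClass L}
    (hK : IsQuasivariety K) (hjep : HasJEP K) (hnt : NontrivialClass K) {I : Type u}
    (S : I → Type u) [iS : ∀ i, L.Structure (S i)]
    (hS : ∀ i, K (S i) (iS i)) (hSn : ∀ i, Nontrivial (S i)) :
    ∃ (B : Type u) (iB : L.Structure B), K B iB ∧ Nontrivial B ∧
      ∀ i, Nonempty (S i →[L] B) := by
  classical
  choose B iB hB hBn e using hjep.exists_finset_target hnt S hS hSn
  obtain ⟨uf, huf⟩ := exists_ultrafilter_le_atTop (Finset I)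
  refine ⟨(uf : Filter (Finset I)).Product B, inferInstance, hK.ultra_closed _ B uf hB, ?_,
    fun i => ?_⟩
  · choose x y hxy using fun F => (hBn F).exists_pair_ne
    refine ⟨(x : (uf : Filter (Finset I)).Product B), y, fun h => ?_⟩
    have h' : ∀ᶠ F in (uf : Filter (Finset I)), x F = y F := Quotient.exact h
    obtain ⟨F, hF⟩ := h'.exists
    exact hxy F hF
  · refine ⟨homToUltraproduct uf B
      (fun x F => if h : i ∈ F then (e F i h).some x else (hBn F).to_nonempty.some)
      fun g x => (huf {i}).mono fun F hF => ?_⟩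
    have hi : i ∈ F := hF (Finset.mem_singleton_self i)
    simp only [hi, dite_true]
    exact (e F i hi).some.map_fun g x

/-- A structure belongs to a quasivariety as soon as all its finitely generated nonempty
substructures do. -/
theorem IsQuasivariety.mem_of_closure_mem [L.IsAlgebraic] {K : StructClass L}
    (hK : IsQuasivariety K) (M : Type u) [iM : L.Structure M]
    (h : ∀ F : Finset M, F.Nonempty →
      K (Substructure.closure L (F : Set M)) inferInstance) : K M iM := by
  classical
  rcases isEmpty_or_nonempty M with hM | ⟨⟨m⟩⟩
  · exact hK.mem_of_separated M fun a => isEmptyElim a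
  let N : Finset M → Type u := fun F => Substructure.closure L ((insert m F : Finset M) : Set M)
  let iN : ∀ F, L.Structure (N F) := fun F => inferInstanceAs
    (L.Structure (Substructure.closure L ((insert m F : Finset M) : Set M)))
  obtain ⟨uf, huf⟩ := exists_ultrafilter_le_atTop (Finset M)
  have hmem : ∀ {F : Finset M} {a : M}, a ∈ F →
      a ∈ Substructure.closure L ((insert m F : Finset M) : Set M) := fun ha =>
    Substructure.subset_closure (Finset.mem_coe.2 (Finset.mem_insert_of_mem ha))
  have hm : ∀ F : Finset M, m ∈ Substructure.closure L ((insert m F : Finset M) : Set M) :=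
    fun F => Substructure.subset_closure (Finset.mem_coe.2 (Finset.mem_insert_self m F))
  let f : M → ∀ F, N F := fun a F => if ha : a ∈ F then ⟨a, hmem ha⟩ else ⟨m, hm F⟩
  have hfa : ∀ {F : Finset M} {a : M}, a ∈ F → (f a F).1 = a := fun ha => by simp [f, ha]
  have hf : ∀ {n : ℕ} (g : L.Functions n) (x : Fin n → M),
      ∀ᶠ F in (uf : Filter (Finset M)), f (funMap g x) F = funMap g fun j => f (x j) F := by
    intro n g x
    refine (huf (insert (funMap g x) (Finset.univ.image x))).mono fun F hF => Subtype.ext ?_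
    rw [hfa (hF (Finset.mem_insert_self _ _))]
    refine congrArg (funMap g) (funext fun j => (hfa (hF ?_)).symm)
    exact Finset.mem_insert_of_mem (Finset.mem_image_of_mem x (Finset.mem_univ j))
  have hinj : Function.Injective (homToUltraproduct uf N f hf) := by
    intro a b hab
    obtain ⟨F, hF, hle⟩ := (((homToUltraproduct_eq_iff uf N f hf a b).1 hab).and
      (huf {a, b})).exists
    rw [← hfa (hle (Finset.mem_insert_self a {b})), hF,
      hfa (hle (Finset.mem_insert_of_mem (Finset.mem_singleton_self b)))]
  exact hK.sub_closed M _ ⟨Embedding.ofInjective hinj⟩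
    (hK.ultra_closed _ N uf fun F => h _ (Finset.insert_nonempty m F))

/-- The closure of a nonempty finite set is covered by the terms in countably many variables. -/
theorem exists_surjective_closure {M : Type u} [L.Structure M] {F : Finset M}
    (hF : F.Nonempty) :
    ∃ g : L.Term ℕ → Substructure.closure L (F : Set M), Function.Surjective g := by
  have : Nonempty (F : Set M) := hF.to_subtype
  obtain ⟨v, hv⟩ := exists_surjective_nat (F : Set M)
  refine ⟨fun t => ⟨t.realize fun n => (v n : M), t.realize_mem _ fun n =>
    Substructure.subset_closure (v n).2⟩, ?_⟩
  rintro ⟨x, hx⟩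
  obtain ⟨t, rfl⟩ := Substructure.mem_closure_iff_exists_term.1 hx
  refine ⟨t.relabel (Function.surjInv hv), Subtype.ext ?_⟩
  simp [Term.realize_relabel, Function.comp_def, Function.surjInv_eq hv]

/-- A homomorphism from a relatively simple structure to a nontrivial member of a Kollár
quasivariety is injective. -/
theorem RelSimple.injective_s8 [L.IsAlgebraic] {K : StructClass L} (hK : IsQuasivariety K)
    (hkol : IsKollar K) {S A : Type u} [L.Structure S] [iA : L.Structure A] (hS : RelSimple K S)
    (hA : K A iA) (hAn : Nontrivial A) (f : S →[L] A) : Function.Injective f := by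
  obtain ⟨-, hSn, hSs⟩ := hS
  have hR : K f.range inferInstance := hK.sub_closed _ A ⟨f.range.subtype⟩ hA
  have hRn : Nontrivial f.range := by
    by_contra hn
    rw [not_nontrivial_iff_subsingleton] at hn
    obtain ⟨s⟩ := hSn.to_nonempty
    refine hkol A hA hAn ⟨f s, fun n g => ?_⟩
    have := Subsingleton.elim (funMap g fun _ => (⟨f s, f.mem_range_self s⟩ : f.range))
      ⟨f s, f.mem_range_self s⟩
    exact congrArg Subtype.val this
  have := hSs f.range hR hRn (f.codRestrict f.range f.mem_range_self) (by
    rintro ⟨_, x, rfl⟩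
    exact ⟨x, rfl⟩)
  exact fun x y hxy => this (Subtype.ext hxy)

/-- In a quasivariety with the JEP, some nontrivial member receives homomorphisms from all
nontrivial members covered by a fixed small type. -/
theorem IsQuasivariety.exists_universal_target [L.IsAlgebraic] {K : StructClass L}
    (hK : IsQuasivariety K) (hjep : HasJEP K) (hnt : NontrivialClass K) (X : Type u) :
    ∃ (B : Type u) (iB : L.Structure B), K B iB ∧ Nontrivial B ∧
      ∀ (S : Type u) [iS : L.Structure S], K S iS → Nontrivial S →
        (∃ g : X → S, Function.Surjective g) → Nonempty (S →[L] B) := by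
  let I := {p : Σ s : Set X, L.Structure s // K p.1 p.2 ∧ Nontrivial p.1}
  let iI : ∀ i : I, L.Structure i.1.1 := fun i => i.1.2
  obtain ⟨B, iB, hB, hBn, h⟩ := hK.exists_common_target hjep hnt (fun i : I => (i.1.1 : Type u))
    (fun i => i.2.1) (fun i => i.2.2)
  refine ⟨B, iB, hB, hBn, fun S iS hS hSn ⟨g, hg⟩ => ?_⟩
  let e : S ≃ Set.range (Function.surjInv hg) :=
    Equiv.ofInjective _ (Function.injective_surjInv hg)
  let iR : L.Structure (Set.range (Function.surjInv hg)) := e.inducedStructure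
  let E : S ≃[L] Set.range (Function.surjInv hg) := e.inducedStructureEquiv
  obtain ⟨f⟩ := h ⟨⟨Set.range (Function.surjInv hg), iR⟩,
    hK.iso_closed S _ ⟨E⟩ hS, e.symm.nontrivial⟩
  exact ⟨Hom.comp f E.toHom⟩

/-- a nontrivial relatively semisimple Kollár quasivariety with
the JEP is generated (as a quasivariety) by one relatively simple member. -/
theorem statement_8 (L : FirstOrder.Language.{u, u}) (halg : L.IsAlgebraic)
    (K : StructClass L) (hK : IsQuasivariety K) (hkol : IsKollar K)
    (hnt : NontrivialClass K) (hss : RelSemisimple K) (hjep : HasJEP K) :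
    ∃ (A : Type u) (iA : L.Structure A), @RelSimple L K A iA ∧
      EqClass K (QGen (@ClassOf L A iA)) := by
  have : L.IsAlgebraic := halg
  obtain ⟨B, iB, hB, hBn, hhom⟩ := hK.exists_universal_target hjep hnt (L.Term ℕ)
  obtain ⟨a, b, hab⟩ := hBn.exists_pair_ne
  obtain ⟨A, iA, hA, p, -, -⟩ := hK.exists_relSDI_separating B hB hab
  have hAs : RelSimple K A := hss A hA.1 hA
  refine ⟨A, iA, hAs, fun M iM => ⟨fun hM K' hK' hAK' => ?_, fun hM => hM K hK ?_⟩⟩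
  · refine hK'.mem_of_closure_mem M fun F hF => ?_
    obtain ⟨g, hg⟩ := exists_surjective_closure (L := L) hF
    refine hK'.mem_of_separated _ fun x y hxy => ?_
    obtain ⟨S, iS, hS, q, hq, hqxy⟩ := hK.exists_relSDI_separating _
      (hK.sub_closed _ M ⟨(Substructure.closure L (F : Set M)).subtype⟩ hM) hxy
    have hSs : RelSimple K S := hss S hS.1 hS
    obtain ⟨f⟩ := hhom S hS.1 hSs.2.1 ⟨q ∘ g, hq.comp hg⟩
    exact ⟨A, iA, hAK' A iA ⟨Language.Equiv.refl L A⟩, (p.comp f).comp q, fun he =>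
      hqxy (hSs.injective_s8 hK hkol hA.1 hAs.2.1 (p.comp f) he)⟩
  · exact fun N iN ⟨e⟩ => hK.iso_closed A N ⟨e.symm⟩ hA.1

end Paper
end
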